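/- Let H be a quasi-Hopf algebra over a field k with bijective antipode S (inverse S̄), μ : H → k an algebra map, and g a pivotal element of H. For t ∈ H* the following are equivalent: (i) t(h)·1 = μ(φ̄1)·t((q^R_1 ↼ μ)·φ̄2 h_(1) p^R_1)·g q^R_2 φ̄3 h_(2) p^R_2 for all h ∈ H, where h ↼ μ = μ(h_(1))h_(2); (ii) the linear form λ ∈ H* defined by λ(h) = t(g⁻¹S(h)) satisfies V^L_1 h_(1) W^L_1 · ⟨λ, V^L_2 h_(2) W^L_2⟩ = λ(h)·1 for all h ∈ H. -/

import Mathlib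

open scoped TensorProduct

noncomputable section

/-- A quasi-Hopf algebra over a field `k`, presented together with explicit
(Sweedler-style) finite representations of the comultiplication and of the
associator `φ` and its inverse `φ⁻¹`.  The fields `n, d1, d2` give, for every
`h : H`, a finite family with `Δ h = ∑ i < n h, d1 h i ⊗ d2 h i`; similarly
`P1, P2, P3` (resp. `Q1, Q2, Q3`) are the components of `φ` (resp. `φ⁻¹`). -/
structure QuasiHopf (k H : Type) [Field k] [Ring H] [Algebra k H] where
  comul : H →ₐ[k] H ⊗[k] H
  counit : H →ₐ[k] k
  n : H → ℕ
  d1 : H → ℕ → H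
  d2 : H → ℕ → H
  comul_eq : ∀ h, comul h = ∑ i ∈ Finset.range (n h), d1 h i ⊗ₜ[k] d2 h i
  np : ℕ
  P1 : ℕ → H
  P2 : ℕ → H
  P3 : ℕ → H
  nq : ℕ
  Q1 : ℕ → H
  Q2 : ℕ → H
  Q3 : ℕ → H
  S : H →ₗ[k] H
  Sinv : H →ₗ[k] H
  alpha : H
  beta : H
  S_one : S 1 = 1
  S_mul : ∀ x y : H, S (x * y) = S y * S x
  Sinv_S : ∀ x : H, Sinv (S x) = x
  S_Sinv : ∀ x : H, S (Sinv x) = x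
  phi_phiInv :
    (∑ a ∈ Finset.range np, P1 a ⊗ₜ[k] (P2 a ⊗ₜ[k] P3 a)) *
      (∑ b ∈ Finset.range nq, Q1 b ⊗ₜ[k] (Q2 b ⊗ₜ[k] Q3 b)) = 1
  phiInv_phi :
    (∑ b ∈ Finset.range nq, Q1 b ⊗ₜ[k] (Q2 b ⊗ₜ[k] Q3 b)) *
      (∑ a ∈ Finset.range np, P1 a ⊗ₜ[k] (P2 a ⊗ₜ[k] P3 a)) = 1
  qcoassoc : ∀ h : H,
    ∑ i ∈ Finset.range (n h), d1 h i ⊗ₜ[k] comul (d2 h i) =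
      (∑ a ∈ Finset.range np, P1 a ⊗ₜ[k] (P2 a ⊗ₜ[k] P3 a)) *
        (∑ i ∈ Finset.range (n h), ∑ j ∈ Finset.range (n (d1 h i)),
          d1 (d1 h i) j ⊗ₜ[k] (d2 (d1 h i) j ⊗ₜ[k] d2 h i)) *
        (∑ b ∈ Finset.range nq, Q1 b ⊗ₜ[k] (Q2 b ⊗ₜ[k] Q3 b))
  counit_left : ∀ h : H, ∑ i ∈ Finset.range (n h), counit (d1 h i) • d2 h i = h
  counit_right : ∀ h : H, ∑ i ∈ Finset.range (n h), counit (d2 h i) • d1 h i = h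
  pentagon :
    (∑ a ∈ Finset.range np, P1 a ⊗ₜ[k] (P2 a ⊗ₜ[k] comul (P3 a))) *
      (∑ a ∈ Finset.range np, ∑ i ∈ Finset.range (n (P1 a)),
        d1 (P1 a) i ⊗ₜ[k] (d2 (P1 a) i ⊗ₜ[k] (P2 a ⊗ₜ[k] P3 a))) =
    ((1 : H) ⊗ₜ[k] (∑ a ∈ Finset.range np, P1 a ⊗ₜ[k] (P2 a ⊗ₜ[k] P3 a))) *
      (∑ a ∈ Finset.range np, ∑ i ∈ Finset.range (n (P2 a)),
        P1 a ⊗ₜ[k] (d1 (P2 a) i ⊗ₜ[k] (d2 (P2 a) i ⊗ₜ[k] P3 a))) *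
      (∑ a ∈ Finset.range np, P1 a ⊗ₜ[k] (P2 a ⊗ₜ[k] (P3 a ⊗ₜ[k] (1 : H))))
  counit_mid_phi :
    ∑ a ∈ Finset.range np, counit (P2 a) • (P1 a ⊗ₜ[k] P3 a) = (1 : H) ⊗ₜ[k] (1 : H)
  antipode_alpha : ∀ h : H,
    ∑ i ∈ Finset.range (n h), S (d1 h i) * alpha * d2 h i = counit h • alpha
  antipode_beta : ∀ h : H,
    ∑ i ∈ Finset.range (n h), d1 h i * beta * S (d2 h i) = counit h • beta
  nondeg_1 : ∑ a ∈ Finset.range np, P1 a * beta * S (P2 a) * alpha * P3 a = 1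
  nondeg_2 : ∑ b ∈ Finset.range nq, S (Q1 b) * alpha * Q2 b * beta * S (Q3 b) = 1
  counit_alpha : counit alpha = 1
  counit_beta : counit beta = 1

namespace QuasiHopf

variable {k H : Type} [Field k] [Ring H] [Algebra k H] (q : QuasiHopf k H)

/-- The associator `φ` as an element of `H ⊗ H ⊗ H`. -/
def Phi : H ⊗[k] (H ⊗[k] H) :=
  ∑ a ∈ Finset.range q.np, q.P1 a ⊗ₜ[k] (q.P2 a ⊗ₜ[k] q.P3 a)

/-- `φ⁻¹` as an element of `H ⊗ H ⊗ H`. -/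
def PhiInv : H ⊗[k] (H ⊗[k] H) :=
  ∑ b ∈ Finset.range q.nq, q.Q1 b ⊗ₜ[k] (q.Q2 b ⊗ₜ[k] q.Q3 b)

/-- first components of `p^R = φ̄1 ⊗ φ̄2 β S(φ̄3)` -/
def pR1 (b : ℕ) : H := q.Q1 b

def pR2 (b : ℕ) : H := q.Q2 b * q.beta * q.S (q.Q3 b)

def pRE : H ⊗[k] H := ∑ b ∈ Finset.range q.nq, q.pR1 b ⊗ₜ[k] q.pR2 b

/-- components of `q^R = φ1 ⊗ S̄(α φ3) φ2` -/
def qR1 (a : ℕ) : H := q.P1 a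

def qR2 (a : ℕ) : H := q.Sinv (q.alpha * q.P3 a) * q.P2 a

def qRE : H ⊗[k] H := ∑ a ∈ Finset.range q.np, q.qR1 a ⊗ₜ[k] q.qR2 a

/-- components of `p^L = φ2 S̄(φ1 β) ⊗ φ3` -/
def pL1 (a : ℕ) : H := q.P2 a * q.Sinv (q.P1 a * q.beta)

def pL2 (a : ℕ) : H := q.P3 a

def pLE : H ⊗[k] H := ∑ a ∈ Finset.range q.np, q.pL1 a ⊗ₜ[k] q.pL2 a

/-- components of `q^L = S(φ̄1) α φ̄2 ⊗ φ̄3` -/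
def qL1 (b : ℕ) : H := q.S (q.Q1 b) * q.alpha * q.Q2 b

def qL2 (b : ℕ) : H := q.Q3 b

def qLE : H ⊗[k] H := ∑ b ∈ Finset.range q.nq, q.qL1 b ⊗ₜ[k] q.qL2 b

/-- `𝕒 = S(φ̄1 φ2) α φ̄2 φ3₍₁₎ ⊗ S(φ1) α φ̄3 φ3₍₂₎` -/
def aEl : H ⊗[k] H :=
  ∑ a ∈ Finset.range q.np, ∑ b ∈ Finset.range q.nq, ∑ m ∈ Finset.range (q.n (q.P3 a)),
    (q.S (q.Q1 b * q.P2 a) * q.alpha * q.Q2 b * q.d1 (q.P3 a) m) ⊗ₜ[k]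
      (q.S (q.P1 a) * q.alpha * q.Q3 b * q.d2 (q.P3 a) m)

/-- `𝕓 = φ1₍₁₎ φ̄1 β S(φ3) ⊗ φ1₍₂₎ φ̄2 β S(φ2 φ̄3)` -/
def bEl : H ⊗[k] H :=
  ∑ a ∈ Finset.range q.np, ∑ b ∈ Finset.range q.nq, ∑ m ∈ Finset.range (q.n (q.P1 a)),
    (q.d1 (q.P1 a) m * q.Q1 b * q.beta * q.S (q.P3 a)) ⊗ₜ[k]
      (q.d2 (q.P1 a) m * q.Q2 b * q.beta * q.S (q.P2 a * q.Q3 b))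

/-- `(S ⊗ S)(Δ^cop x) = S(x₍₂₎) ⊗ S(x₍₁₎)` -/
def scop (x : H) : H ⊗[k] H :=
  ∑ m ∈ Finset.range (q.n x), q.S (q.d2 x m) ⊗ₜ[k] q.S (q.d1 x m)

/-- The Drinfeld twist `f = (S⊗S)(Δ^cop(p^R_1)) · 𝕒 · Δ(p^R_2)`. -/
def twist : H ⊗[k] H :=
  ∑ b ∈ Finset.range q.nq, q.scop (q.pR1 b) * q.aEl * q.comul (q.pR2 b)

/-- `f⁻¹ = Δ(q^L_1) · 𝕓 · (S⊗S)(Δ^cop(q^L_2))`. -/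
def twistInv : H ⊗[k] H :=
  ∑ b ∈ Finset.range q.nq, q.comul (q.qL1 b) * q.bEl * q.scop (q.qL2 b)

/-- `x ⊗ y ↦ S y ⊗ S x` -/
def sswap : H ⊗[k] H →ₗ[k] H ⊗[k] H :=
  (TensorProduct.map q.S q.S).comp (TensorProduct.comm k H H).toLinearMap

/-- `x ⊗ y ↦ S̄ y ⊗ S̄ x` -/
def sswapInv : H ⊗[k] H →ₗ[k] H ⊗[k] H :=
  (TensorProduct.map q.Sinv q.Sinv).comp (TensorProduct.comm k H H).toLinearMap

/-- `U^L = f̄1 S(q^R_2) ⊗ f̄2 S(q^R_1)` -/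
def UL : H ⊗[k] H := q.twistInv * q.sswap q.qRE

/-- `V^L = S̄(f2 p^R_2) ⊗ S̄(f1 p^R_1)` -/
def VL : H ⊗[k] H := q.sswapInv (q.twist * q.pRE)

/-- `U^R = S̄(q^L_2 f̄2) ⊗ S̄(q^L_1 f̄1)` -/
def UR : H ⊗[k] H := q.sswapInv (q.qLE * q.twistInv)

/-- `V^R = S(p^L_2) f1 ⊗ S(p^L_1) f2` -/
def VR : H ⊗[k] H := q.sswap q.pLE * q.twist

/-- `h ↦ h ↼ μ = μ(h₍₁₎) h₍₂₎` -/
def lhook (mu : H →ₐ[k] k) : H →ₗ[k] H :=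
  (TensorProduct.lid k H).toLinearMap.comp
    ((TensorProduct.map mu.toLinearMap LinearMap.id).comp q.comul.toLinearMap)

/-- `h ↦ μ ⇀ h = μ(h₍₂₎) h₍₁₎` -/
def rhook (mu : H →ₐ[k] k) : H →ₗ[k] H :=
  (TensorProduct.rid k H).toLinearMap.comp
    ((TensorProduct.map LinearMap.id mu.toLinearMap).comp q.comul.toLinearMap)

/-- `W^L = μ(φ̄1) f̄1 S(q^R_2 φ̄3) ⊗ f̄2 S((q^R_1 ↼ μ) φ̄2)` -/
def WL (mu : H →ₐ[k] k) : H ⊗[k] H :=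
  q.twistInv * q.sswap ((TensorProduct.map (q.lhook mu) LinearMap.id q.qRE) *
    (∑ b ∈ Finset.range q.nq, mu (q.Q1 b) • (q.Q2 b ⊗ₜ[k] q.Q3 b)))

/-- `W^R = μ(φ3) S̄((μ ⇀ q^L_2) φ2 f̄2) ⊗ S̄(q^L_1 φ1 f̄1)` -/
def WR (mu : H →ₐ[k] k) : H ⊗[k] H :=
  q.sswapInv ((TensorProduct.map LinearMap.id (q.rhook mu) q.qLE) *
    (∑ a ∈ Finset.range q.np, mu (q.P3 a) • (q.P1 a ⊗ₜ[k] q.P2 a)) * q.twistInv)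

section Modules

variable {V W X : Type} [AddCommGroup V] [Module k V] [AddCommGroup W] [Module k W]
  [AddCommGroup X] [Module k X]

/-- The tensor-product action `h · (v ⊗ w) = h₍₁₎ v ⊗ h₍₂₎ w`. -/
def tensAct (ρV : H → Module.End k V) (ρW : H → Module.End k W) (h : H) :
    Module.End k (V ⊗[k] W) :=
  ∑ i ∈ Finset.range (q.n h), TensorProduct.map (ρV (q.d1 h i)) (ρW (q.d2 h i))

/-- The action on the left dual: `(h · ξ)(x) = ξ(S(h) x)`. -/
def dualAct (ρX : H → Module.End k X) (h : H) : Module.End k (Module.Dual k X) :=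
  LinearMap.dualMap (ρX (q.S h))

end Modules

end QuasiHopf

/-- `f` intertwines the two given `H`-actions. -/
def IsHLin {k H V W : Type} [Field k] [Ring H] [Algebra k H]
    [AddCommGroup V] [Module k V] [AddCommGroup W] [Module k W]
    (ρV : H → Module.End k V) (ρW : H → Module.End k W) (f : V →ₗ[k] W) : Prop :=
  ∀ (h : H) (v : V), f (ρV h v) = ρW h (f v)

/-- `x ⊗ y ↦ λ(y) • x` -/
def hitR {k H : Type} [Field k] [Ring H] [Algebra k H] (lam : H →ₗ[k] k) :
    H ⊗[k] H →ₗ[k] H :=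
  (TensorProduct.rid k H).toLinearMap.comp (TensorProduct.map LinearMap.id lam)

/-- `x ⊗ y ↦ λ(x) • y` -/
def hitL {k H : Type} [Field k] [Ring H] [Algebra k H] (lam : H →ₗ[k] k) :
    H ⊗[k] H →ₗ[k] H :=
  (TensorProduct.lid k H).toLinearMap.comp (TensorProduct.map lam LinearMap.id)

namespace QuasiHopf

section Legs

variable {k A B C D R : Type} [Field k] [Ring A] [Algebra k A] [Ring B] [Algebra k B]
  [Ring C] [Algebra k C] [Ring D] [Algebra k D] [Ring R] [Algebra k R]

/-- A linear map is unital and multiplicative. -/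
structure IsHom (a : A →ₗ[k] R) : Prop where
  one : a 1 = 1
  mul : ∀ x y, a (x * y) = a x * a y

/-- The images of two linear maps commute elementwise. -/
def Commuting (a : A →ₗ[k] R) (b : B →ₗ[k] R) : Prop :=
  ∀ x y, Commute (a x) (b y)

/-- `x ⊗ y ↦ a x * b y` -/
def join (a : A →ₗ[k] R) (b : B →ₗ[k] R) : A ⊗[k] B →ₗ[k] R :=
  LinearMap.mul' k R ∘ₗ TensorProduct.map a b

@[simp]
lemma join_tmul (a : A →ₗ[k] R) (b : B →ₗ[k] R) (x : A) (y : B) :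
    join a b (x ⊗ₜ[k] y) = a x * b y := by
  simp [join]

lemma Commuting.symm {a : A →ₗ[k] R} {b : B →ₗ[k] R} (h : Commuting a b) : Commuting b a :=
  fun x y => (h y x).symm

lemma Commuting.join_left {a : A →ₗ[k] R} {b : B →ₗ[k] R} {c : C →ₗ[k] R}
    (hac : Commuting a c) (hbc : Commuting b c) : Commuting (join a b) c := by
  intro X y
  induction X using TensorProduct.induction_on with
  | zero => simp
  | tmul x z => simpa using (hac x y).mul_left (hbc z y)
  | add X Y hX hY => simpa using hX.add_left hY

lemma Commuting.join_right {a : A →ₗ[k] R} {b : B →ₗ[k] R} {c : C →ₗ[k] R}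
    (hca : Commuting c a) (hcb : Commuting c b) : Commuting c (join a b) :=
  (hca.symm.join_left hcb.symm).symm

lemma IsHom.join {a : A →ₗ[k] R} {b : B →ₗ[k] R} (ha : IsHom a) (hb : IsHom b)
    (hab : Commuting a b) : IsHom (join a b) where
  one := by simp [Algebra.TensorProduct.one_def, ha.one, hb.one]
  mul X Y := by
    induction X using TensorProduct.induction_on with
    | zero => simp
    | add X X' hX hX' => simp [add_mul, hX, hX']
    | tmul x x' =>
      induction Y using TensorProduct.induction_on with
      | zero => simp
      | add Y Y' hY hY' => simp [mul_add, hY, hY']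
      | tmul y y' =>
        simp only [Algebra.TensorProduct.tmul_mul_tmul, join_tmul, ha.mul, hb.mul]
        rw [mul_assoc, mul_assoc, ← mul_assoc (a y), (hab y x').eq, mul_assoc]

end Legs

section Calculus

variable {k H R M : Type} [Field k] [Ring H] [Algebra k H] (q : QuasiHopf k H)
  [Ring R] [Algebra k R] [AddCommGroup M] [Module k M]

/-- `h ↦ a h₍₁₎ * b h₍₂₎` -/
def star (a b : H →ₗ[k] R) : H →ₗ[k] R := join a b ∘ₗ q.comul.toLinearMap

/-- The associator placed in the legs `a, b, c`. -/
def assoc (a b c : H →ₗ[k] R) : R := join a (join b c) q.Phi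

/-- The inverse associator placed in the legs `a, b, c`. -/
def assocInv (a b c : H →ₗ[k] R) : R := join a (join b c) q.PhiInv

/-- `h ↦ ε(h) 1` -/
def unitLeg : H →ₗ[k] R := Algebra.linearMap k R ∘ₗ q.counit.toLinearMap

lemma unitLeg_apply (h : H) : q.unitLeg (R := R) h = algebraMap k R (q.counit h) := rfl

lemma star_apply (a b : H →ₗ[k] R) (h : H) :
    q.star a b h = ∑ i ∈ Finset.range (q.n h), a (q.d1 h i) * b (q.d2 h i) := by
  simp [star, q.comul_eq]

lemma assoc_eq (a b c : H →ₗ[k] R) :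
    q.assoc a b c = ∑ i ∈ Finset.range q.np, a (q.P1 i) * (b (q.P2 i) * c (q.P3 i)) := by
  simp [assoc, Phi]

lemma assocInv_eq (a b c : H →ₗ[k] R) :
    q.assocInv a b c = ∑ i ∈ Finset.range q.nq, a (q.Q1 i) * (b (q.Q2 i) * c (q.Q3 i)) := by
  simp [assocInv, PhiInv]

variable {a b c d a' b' c' : H →ₗ[k] R}

@[simp]
lemma Commuting.star_left (hac : Commuting a c) (hbc : Commuting b c) :
    Commuting (q.star a b) c :=
  fun x y => (hac.join_left hbc) (q.comul x) y

@[simp]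
lemma Commuting.star_right (hca : Commuting c a) (hcb : Commuting c b) :
    Commuting c (q.star a b) :=
  (hca.symm.star_left q hcb.symm).symm

@[simp]
lemma IsHom.star (ha : IsHom a) (hb : IsHom b) (hab : Commuting a b) :
    IsHom (q.star a b) where
  one := by simp [QuasiHopf.star, (ha.join hb hab).one]
  mul x y := by simp [QuasiHopf.star, (ha.join hb hab).mul]

@[simp]
lemma isHom_unitLeg : IsHom (q.unitLeg (R := R)) where
  one := by simp [unitLeg_apply]
  mul := by simp [unitLeg_apply]

@[simp]
lemma commuting_unitLeg_left : Commuting q.unitLeg a :=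
  fun _ _ => Algebra.commutes _ _

@[simp]
lemma commuting_unitLeg_right : Commuting a q.unitLeg :=
  q.commuting_unitLeg_left.symm

@[simp]
lemma star_unitLeg_left : q.star q.unitLeg a = a := by
  ext h
  conv_rhs => rw [← q.counit_left h]
  simp only [map_sum, map_smul]
  simp only [star_apply, unitLeg_apply, Algebra.smul_def]

@[simp]
lemma star_unitLeg_right : q.star a q.unitLeg = a := by
  ext h
  conv_rhs => rw [← q.counit_right h]
  simp only [map_sum, map_smul]
  simp only [star_apply, unitLeg_apply, Algebra.smul_def, Algebra.commutes]

lemma assoc_mul_assocInv (ha : IsHom a) (hb : IsHom b) (hc : IsHom c) (hab : Commuting a b)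
    (hac : Commuting a c) (hbc : Commuting b c) : q.assoc a b c * q.assocInv a b c = 1 := by
  have hom := ha.join (hb.join hc hbc) (hab.join_right hac)
  rw [assoc, assocInv, ← hom.mul, ← hom.one]
  exact congrArg _ q.phi_phiInv

lemma assocInv_mul_assoc (ha : IsHom a) (hb : IsHom b) (hc : IsHom c) (hab : Commuting a b)
    (hac : Commuting a c) (hbc : Commuting b c) : q.assocInv a b c * q.assoc a b c = 1 := by
  have hom := ha.join (hb.join hc hbc) (hab.join_right hac)
  rw [assoc, assocInv, ← hom.mul, ← hom.one]
  exact congrArg _ q.phiInv_phi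

lemma star_star_mul_assoc (ha : IsHom a) (hb : IsHom b) (hc : IsHom c) (hab : Commuting a b)
    (hac : Commuting a c) (hbc : Commuting b c) (h : H) :
    q.assoc a b c * q.star (q.star a b) c h = q.star a (q.star b c) h * q.assoc a b c := by
  have hom := ha.join (hb.join hc hbc) (hab.join_right hac)
  have e := congrArg (fun X => join a (join b c) X * q.assoc a b c) (q.qcoassoc h)
  have e' := q.assocInv_mul_assoc ha hb hc hab hac hbc
  rw [assocInv, PhiInv] at e'
  simp only [hom.mul] at e
  rw [mul_assoc _ _ (q.assoc a b c), e', mul_one] at e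
  rw [star_apply, star_apply]
  have e1 : ∀ i, a (q.d1 h i) * q.star b c (q.d2 h i) =
      join a (join b c) (q.d1 h i ⊗ₜ[k] q.comul (q.d2 h i)) := by
    intro i; simp [star]
  simp only [e1]
  rw [← map_sum, e, assoc, Phi]
  congr 1
  simp [star_apply, Finset.sum_mul, mul_assoc]

lemma assoc_pentagon (ha : IsHom a) (hb : IsHom b) (hc : IsHom c) (hd : IsHom d)
    (hab : Commuting a b) (hac : Commuting a c) (had : Commuting a d) (hbc : Commuting b c)
    (hbd : Commuting b d) (hcd : Commuting c d) :
    q.assoc a b (q.star c d) * q.assoc (q.star a b) c d =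
      q.assoc b c d * q.assoc a (q.star b c) d * q.assoc a b c := by
  have hom : IsHom (join a (join b (join c d))) :=
    ha.join (hb.join (hc.join hd hcd) (hbc.join_right hbd)) (hab.join_right (hac.join_right had))
  have e := congrArg (join a (join b (join c d))) q.pentagon
  simp only [hom.mul] at e
  convert e using 2
  · simp [assoc_eq, star]
  · simp [assoc_eq, star_apply, Finset.sum_mul, mul_assoc]
  · congr 1
    · simp [assoc_eq, ha.one]
    · simp [assoc_eq, star_apply, Finset.sum_mul, Finset.mul_sum, mul_assoc]
  · simp [assoc_eq, hd.one]

lemma assoc_unitLeg_mid (ha : IsHom a) (hc : IsHom c) : q.assoc a q.unitLeg c = 1 := by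
  have e := congrArg (join a c) q.counit_mid_phi
  simp only [map_sum, map_smul, join_tmul, ha.one, hc.one, mul_one] at e
  rw [← e, assoc_eq]
  refine Finset.sum_congr rfl fun i _ => ?_
  rw [unitLeg_apply, Algebra.smul_def, ← mul_assoc, ← Algebra.commutes, mul_assoc]

lemma assoc_unitLeg_left (hb : IsHom b) (hc : IsHom c) (hbc : Commuting b c) :
    q.assoc q.unitLeg b c = 1 := by
  have e := q.assoc_pentagon (a := q.unitLeg) (b := q.unitLeg) (c := b) (d := c)
    (by simp) (by simp) hb hc (by simp) (by simp) (by simp) (by simp) (by simp) hbc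
  rw [q.assoc_unitLeg_mid (by simp) (by simp [*]), q.assoc_unitLeg_mid (by simp) hb] at e
  simp only [star_unitLeg_left, one_mul, mul_one] at e
  have inv := q.assoc_mul_assocInv (a := q.unitLeg) (by simp) hb hc (by simp) (by simp) hbc
  have e2 := congrArg (· * q.assocInv q.unitLeg b c) e
  simpa [mul_assoc, inv] using e2.symm

lemma assoc_unitLeg_right (ha : IsHom a) (hb : IsHom b) (hab : Commuting a b) :
    q.assoc a b q.unitLeg = 1 := by
  have e := q.assoc_pentagon (a := a) (b := b) (c := q.unitLeg) (d := q.unitLeg)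
    ha hb (by simp) (by simp) hab (by simp) (by simp) (by simp) (by simp) (by simp)
  rw [q.assoc_unitLeg_mid (by simp [*]) (by simp), q.assoc_unitLeg_mid hb (by simp)] at e
  simp only [star_unitLeg_right, one_mul, mul_one] at e
  have inv := q.assoc_mul_assocInv (c := q.unitLeg) ha hb (by simp) hab (by simp) (by simp)
  have e2 := congrArg (· * q.assocInv a b q.unitLeg) e
  simpa [mul_assoc, inv] using e2.symm

lemma assocInv_unitLeg_left (hb : IsHom b) (hc : IsHom c) (hbc : Commuting b c) :
    q.assocInv q.unitLeg b c = 1 := by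
  have inv := q.assoc_mul_assocInv (a := q.unitLeg) (by simp) hb hc (by simp) (by simp) hbc
  rwa [q.assoc_unitLeg_left hb hc hbc, one_mul] at inv

lemma assocInv_unitLeg_mid (ha : IsHom a) (hc : IsHom c) (hac : Commuting a c) :
    q.assocInv a q.unitLeg c = 1 := by
  have inv := q.assoc_mul_assocInv (b := q.unitLeg) ha (by simp) hc (by simp) hac (by simp)
  rwa [q.assoc_unitLeg_mid ha hc, one_mul] at inv

lemma assocInv_unitLeg_right (ha : IsHom a) (hb : IsHom b) (hab : Commuting a b) :
    q.assocInv a b q.unitLeg = 1 := by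
  have inv := q.assoc_mul_assocInv (c := q.unitLeg) ha hb (by simp) hab (by simp) (by simp)
  rwa [q.assoc_unitLeg_right ha hb hab, one_mul] at inv

/-- `u` carries the leg `a` to the leg `a'`. -/
def Intertwines (u : R) (a a' : H →ₗ[k] R) : Prop := ∀ h, u * a h = a' h * u

lemma Intertwines.star {u : R} (ha : Intertwines u a a') (hb : Intertwines u b b') :
    Intertwines u (q.star a b) (q.star a' b') := by
  intro h
  simp only [star_apply, Finset.mul_sum, Finset.sum_mul]
  refine Finset.sum_congr rfl fun i _ => ?_
  rw [← mul_assoc, ha, mul_assoc, hb, mul_assoc]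

lemma Intertwines.mul {u v : R} (hu : Intertwines u b c) (hv : Intertwines v a b) :
    Intertwines (u * v) a c := by
  intro h
  rw [mul_assoc, hv, ← mul_assoc, hu, mul_assoc]

lemma Intertwines.inv {u v : R} (hu : Intertwines u a b) (huv : u * v = 1) (hvu : v * u = 1) :
    Intertwines v b a := by
  intro h
  have e := congrArg (fun x => v * x * v) (hu h)
  simp only [mul_assoc, huv, mul_one] at e
  rw [← e, ← mul_assoc v u, hvu, one_mul]

lemma Intertwines.assoc {u : R} (ha : Intertwines u a a') (hb : Intertwines u b b')
    (hc : Intertwines u c c') : u * q.assoc a b c = q.assoc a' b' c' * u := by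
  simp only [assoc_eq, Finset.mul_sum, Finset.sum_mul]
  refine Finset.sum_congr rfl fun i _ => ?_
  rw [← mul_assoc, ha, mul_assoc, ← mul_assoc u, hb, mul_assoc, hc]
  simp only [mul_assoc]

lemma Intertwines.assocInv {u : R} (ha : Intertwines u a a') (hb : Intertwines u b b')
    (hc : Intertwines u c c') : u * q.assocInv a b c = q.assocInv a' b' c' * u := by
  simp only [assocInv_eq, Finset.mul_sum, Finset.sum_mul]
  refine Finset.sum_congr rfl fun i _ => ?_
  rw [← mul_assoc, ha, mul_assoc, ← mul_assoc u, hb, mul_assoc, hc]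
  simp only [mul_assoc]

/-- Under `N`, the leg `a` standing on the far left may be replaced by `a'`. -/
def LeftCollapse (N : R →ₗ[k] M) (a a' : H →ₗ[k] R) : Prop :=
  ∀ h X, N (a h * X) = N (a' h * X)

/-- Under `N`, the leg `a` standing on the far right may be replaced by `a'`. -/
def RightCollapse (N : R →ₗ[k] M) (a a' : H →ₗ[k] R) : Prop :=
  ∀ h X, N (X * a h) = N (X * a' h)

variable {N : R →ₗ[k] M}

@[simp]
lemma LeftCollapse.refl : LeftCollapse N a a := fun _ _ => rfl

@[simp]
lemma RightCollapse.refl : RightCollapse N a a := fun _ _ => rfl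

lemma LeftCollapse.star (ha : LeftCollapse N a a') (hb : LeftCollapse N b b')
    (h1 : Commuting a' b) (h2 : Commuting a' b') :
    LeftCollapse N (q.star a b) (q.star a' b') := by
  intro h X
  simp only [star_apply, Finset.sum_mul, map_sum]
  refine Finset.sum_congr rfl fun i _ => ?_
  rw [mul_assoc, ha, ← mul_assoc, (h1 _ _).eq, mul_assoc, hb, ← mul_assoc, ← (h2 _ _).eq]

lemma RightCollapse.star (ha : RightCollapse N a a') (hb : RightCollapse N b b')
    (h1 : Commuting a b') (h2 : Commuting a' b') :
    RightCollapse N (q.star a b) (q.star a' b') := by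
  intro h X
  simp only [star_apply, Finset.mul_sum, map_sum]
  refine Finset.sum_congr rfl fun i _ => ?_
  rw [← mul_assoc, hb, mul_assoc, (h1 _ _).eq, ← mul_assoc, ha, mul_assoc, ← (h2 _ _).eq]

lemma LeftCollapse.join_apply (ha : LeftCollapse N a a') (hb : LeftCollapse N b b')
    (hc : LeftCollapse N c c') (hab : Commuting a' b) (hab' : Commuting a' b')
    (hac : Commuting a' c) (hac' : Commuting a' c') (hbc : Commuting b' c)
    (hbc' : Commuting b' c') (x y z : H) (X : R) :
    N (a x * (b y * c z) * X) = N (a' x * (b' y * c' z) * X) := by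
  rw [mul_assoc, ha, ← mul_assoc, ((hab x y).mul_right (hac x z)).eq, mul_assoc, mul_assoc, hb,
    ← mul_assoc, (hbc y z).eq, mul_assoc, hc, ← mul_assoc, ← (hbc' y z).eq, ← mul_assoc,
    ← ((hab' x y).mul_right (hac' x z)).eq]

lemma RightCollapse.join_apply (ha : RightCollapse N a a') (hb : RightCollapse N b b')
    (hc : RightCollapse N c c') (hab : Commuting a b') (hab' : Commuting a' b')
    (hac : Commuting a c') (hac' : Commuting a' c') (hbc : Commuting b c')
    (hbc' : Commuting b' c') (x y z : H) (X : R) :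
    N (X * (a x * (b y * c z))) = N (X * (a' x * (b' y * c' z))) := by
  rw [← mul_assoc, ← mul_assoc, hc, mul_assoc, (hbc y z).eq, ← mul_assoc, hb, mul_assoc, mul_assoc,
    ((hac x z).mul_right (hab x y)).eq, ← mul_assoc, ha, mul_assoc,
    ← ((hac' x z).mul_right (hab' x y)).eq, ← (hbc' y z).eq]

lemma LeftCollapse.assoc (ha : LeftCollapse N a a') (hb : LeftCollapse N b b')
    (hc : LeftCollapse N c c') (hab : Commuting a' b) (hab' : Commuting a' b')
    (hac : Commuting a' c) (hac' : Commuting a' c') (hbc : Commuting b' c)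
    (hbc' : Commuting b' c') (X : R) :
    N (q.assoc a b c * X) = N (q.assoc a' b' c' * X) := by
  simp only [assoc_eq, Finset.sum_mul, map_sum]
  exact Finset.sum_congr rfl fun i _ =>
    ha.join_apply hb hc hab hab' hac hac' hbc hbc' _ _ _ _

lemma LeftCollapse.assocInv (ha : LeftCollapse N a a') (hb : LeftCollapse N b b')
    (hc : LeftCollapse N c c') (hab : Commuting a' b) (hab' : Commuting a' b')
    (hac : Commuting a' c) (hac' : Commuting a' c') (hbc : Commuting b' c)
    (hbc' : Commuting b' c') (X : R) :
    N (q.assocInv a b c * X) = N (q.assocInv a' b' c' * X) := by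
  simp only [assocInv_eq, Finset.sum_mul, map_sum]
  exact Finset.sum_congr rfl fun i _ =>
    ha.join_apply hb hc hab hab' hac hac' hbc hbc' _ _ _ _

lemma RightCollapse.assoc (ha : RightCollapse N a a') (hb : RightCollapse N b b')
    (hc : RightCollapse N c c') (hab : Commuting a b') (hab' : Commuting a' b')
    (hac : Commuting a c') (hac' : Commuting a' c') (hbc : Commuting b c')
    (hbc' : Commuting b' c') (X : R) :
    N (X * q.assoc a b c) = N (X * q.assoc a' b' c') := by
  simp only [assoc_eq, Finset.mul_sum, map_sum]
  exact Finset.sum_congr rfl fun i _ =>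
    ha.join_apply hb hc hab hab' hac hac' hbc hbc' _ _ _ _

lemma RightCollapse.assocInv (ha : RightCollapse N a a') (hb : RightCollapse N b b')
    (hc : RightCollapse N c c') (hab : Commuting a b') (hab' : Commuting a' b')
    (hac : Commuting a c') (hac' : Commuting a' c') (hbc : Commuting b c')
    (hbc' : Commuting b' c') (X : R) :
    N (X * q.assocInv a b c) = N (X * q.assocInv a' b' c') := by
  simp only [assocInv_eq, Finset.mul_sum, map_sum]
  exact Finset.sum_congr rfl fun i _ =>
    ha.join_apply hb hc hab hab' hac hac' hbc hbc' _ _ _ _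

end Calculus

section Coherence

variable {k H R M : Type} [Field k] [Ring H] [Algebra k H] (q : QuasiHopf k H)
  [Ring R] [Algebra k R] [AddCommGroup M] [Module k M]

/-- A list of pairwise commuting algebra maps. -/
def Legs (l : List (H →ₗ[k] R)) : Prop := (∀ a ∈ l, IsHom a) ∧ l.Pairwise Commuting

lemma Legs.reverse {l : List (H →ₗ[k] R)} (L : Legs l) : Legs l.reverse :=
  ⟨fun a ha => L.1 a (List.mem_reverse.1 ha),
    List.pairwise_reverse.2 (L.2.imp fun h => h.symm)⟩

variable {a b c d e f a' : H →ₗ[k] R}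

lemma Legs.assoc_mul_assocInv (L : Legs [a, b, c]) :
    q.assoc a b c * q.assocInv a b c = 1 := by
  simp only [Legs, List.pairwise_cons, List.forall_mem_cons] at L
  apply QuasiHopf.assoc_mul_assocInv <;> simp [L]

lemma Legs.assocInv_mul_assoc (L : Legs [a, b, c]) :
    q.assocInv a b c * q.assoc a b c = 1 := by
  simp only [Legs, List.pairwise_cons, List.forall_mem_cons] at L
  apply QuasiHopf.assocInv_mul_assoc <;> simp [L]

/-- The associator as a unit. -/
def assocUnit (L : Legs [a, b, c]) : Rˣ :=
  ⟨q.assoc a b c, q.assocInv a b c, L.assoc_mul_assocInv q, L.assocInv_mul_assoc q⟩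

lemma Legs.intertwines_assoc (L : Legs [a, b, c]) :
    Intertwines (q.assoc a b c) (q.star (q.star a b) c) (q.star a (q.star b c)) := by
  simp only [Legs, List.pairwise_cons, List.forall_mem_cons] at L
  intro h
  apply QuasiHopf.star_star_mul_assoc <;> simp [L]

lemma Legs.intertwines_assocInv (L : Legs [a, b, c]) :
    Intertwines (q.assocInv a b c) (q.star a (q.star b c)) (q.star (q.star a b) c) :=
  (L.intertwines_assoc q).inv (L.assoc_mul_assocInv q) (L.assocInv_mul_assoc q)

lemma intertwines_assoc_self (ha : Commuting a d) (hb : Commuting b d) (hc : Commuting c d) :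
    Intertwines (q.assoc a b c) d d :=
  fun h => (ha.join_left (hb.join_left hc) q.Phi h).eq

lemma intertwines_assocInv_self (ha : Commuting a d) (hb : Commuting b d)
    (hc : Commuting c d) : Intertwines (q.assocInv a b c) d d :=
  fun h => (ha.join_left (hb.join_left hc) q.PhiInv h).eq

lemma group_pentagon {G : Type} [Group G] {A B C D E : G} (h : A * B = C * D * E) :
    A⁻¹ * C = B * E⁻¹ * D⁻¹ ∧ E * B⁻¹ = D⁻¹ * C⁻¹ * A ∧ B⁻¹ * A⁻¹ = E⁻¹ * D⁻¹ * C⁻¹ := by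
  have hB : B = A⁻¹ * (C * D * E) := by rw [← h, inv_mul_cancel_left]
  subst hB
  refine ⟨?_, ?_, ?_⟩ <;> group

lemma Legs.pentagon_forms (L : Legs [a, b, c, d]) :
    q.assocInv a b (q.star c d) * q.assoc b c d =
        q.assoc (q.star a b) c d * q.assocInv a b c * q.assocInv a (q.star b c) d ∧
      q.assoc a b c * q.assocInv (q.star a b) c d =
        q.assocInv a (q.star b c) d * q.assocInv b c d * q.assoc a b (q.star c d) ∧
      q.assocInv (q.star a b) c d * q.assocInv a b (q.star c d) =
        q.assocInv a b c * q.assocInv a (q.star b c) d * q.assocInv b c d := by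
  simp only [Legs, List.pairwise_cons, List.forall_mem_cons] at L
  have L1 : Legs [a, b, q.star c d] := by simp [Legs, L]
  have L2 : Legs [q.star a b, c, d] := by simp [Legs, L]
  have L3 : Legs [b, c, d] := by simp [Legs, L]
  have L4 : Legs [a, q.star b c, d] := by simp [Legs, L]
  have L5 : Legs [a, b, c] := by simp [Legs, L]
  have h : q.assocUnit L1 * q.assocUnit L2 =
      q.assocUnit L3 * q.assocUnit L4 * q.assocUnit L5 := by
    ext
    apply q.assoc_pentagon <;> simp [L]
  obtain ⟨h1, h2, h3⟩ := group_pentagon h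
  exact ⟨congrArg Units.val h1, congrArg Units.val h2, congrArg Units.val h3⟩

/-- The two paths `(12)((3(45))6) → (1((23)4))(56)` agree. -/
lemma Legs.six_coherence (L : Legs [a, b, c, d, e, f]) :
    q.assocInv b c d * q.assoc a b (q.star c d) *
        q.assocInv (q.star a b) (q.star c d) (q.star e f) *
        q.assoc (q.star c d) e f * q.assocInv c d e =
      q.assoc (q.star a (q.star (q.star b c) d)) e f *
        q.assocInv a (q.star (q.star b c) d) e *
        q.assocInv a (q.star (q.star (q.star b c) d) e) f *
        (q.assocInv (q.star b c) d e * q.assocInv b c (q.star d e)) *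
        q.assocInv b (q.star c (q.star d e)) f *
        q.assoc a b (q.star (q.star c (q.star d e)) f) := by
  have L' := L.reverse
  simp only [Legs, List.reverse_cons, List.reverse_nil, List.nil_append, List.cons_append,
    List.pairwise_cons, List.forall_mem_cons] at L L'
  have ibcd : Intertwines (q.assocInv b c d) (q.star b (q.star c d)) (q.star (q.star b c) d) :=
    Legs.intertwines_assocInv q (by simp [Legs, L])
  have icde : Intertwines (q.assocInv c d e) (q.star c (q.star d e)) (q.star (q.star c d) e) :=
    Legs.intertwines_assocInv q (by simp [Legs, L])
  have e1 := (Legs.pentagon_forms q (a := q.star a b) (b := q.star c d) (c := e) (d := f)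
    (by simp [Legs, L])).1
  have n1 : q.assocInv b c d * q.assoc a b (q.star c d) *
        q.assoc (q.star (q.star a b) (q.star c d)) e f =
      q.assoc (q.star a (q.star (q.star b c) d)) e f *
        (q.assocInv b c d * q.assoc a b (q.star c d)) := by
    refine Intertwines.assoc q (Intertwines.mul (b := q.star a (q.star b (q.star c d))) ?_ ?_)
      (Intertwines.mul (b := e) ?_ ?_) (Intertwines.mul (b := f) ?_ ?_)
    · exact (q.intertwines_assocInv_self (by simp [L']) (by simp [L']) (by simp [L'])).star q ibcd
    · exact Legs.intertwines_assoc q (by simp [Legs, L])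
    all_goals first
      | exact q.intertwines_assocInv_self (by simp [L]) (by simp [L]) (by simp [L])
      | exact q.intertwines_assoc_self (by simp [L]) (by simp [L]) (by simp [L])
  have n2 : q.assocInv c d e * q.assocInv (q.star a b) (q.star c (q.star d e)) f =
      q.assocInv (q.star a b) (q.star (q.star c d) e) f * q.assocInv c d e :=
    Intertwines.assocInv q
      (q.intertwines_assocInv_self (by simp [L']) (by simp [L']) (by simp [L'])) icde
      (q.intertwines_assocInv_self (by simp [L]) (by simp [L]) (by simp [L]))
  have e2 := (Legs.pentagon_forms q (a := a) (b := b) (c := q.star c d) (d := e)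
    (by simp [Legs, L])).2.1
  have n3 : q.assocInv b c d * q.assocInv a (q.star b (q.star c d)) e =
      q.assocInv a (q.star (q.star b c) d) e * q.assocInv b c d :=
    Intertwines.assocInv q
      (q.intertwines_assocInv_self (by simp [L']) (by simp [L']) (by simp [L'])) ibcd
      (q.intertwines_assocInv_self (by simp [L]) (by simp [L]) (by simp [L]))
  have n4 : q.assocInv c d e * q.assoc a b (q.star c (q.star d e)) =
      q.assoc a b (q.star (q.star c d) e) * q.assocInv c d e :=
    Intertwines.assoc q
      (q.intertwines_assocInv_self (by simp [L']) (by simp [L']) (by simp [L']))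
      (q.intertwines_assocInv_self (by simp [L']) (by simp [L']) (by simp [L'])) icde
  have e3 := (Legs.pentagon_forms q (a := b) (b := c) (c := d) (d := e) (by simp [Legs, L])).2.2
  have e4 := (Legs.pentagon_forms q (a := a) (b := b) (c := q.star c (q.star d e)) (d := f)
    (by simp [Legs, L])).2.1
  have n5 : q.assocInv (q.star b c) d e * q.assocInv b c (q.star d e) *
        q.assocInv a (q.star b (q.star c (q.star d e))) f =
      q.assocInv a (q.star (q.star (q.star b c) d) e) f *
        (q.assocInv (q.star b c) d e * q.assocInv b c (q.star d e)) := by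
    refine Intertwines.assocInv q (Intertwines.mul (b := a) ?_ ?_)
      (Intertwines.mul (b := q.star (q.star b c) (q.star d e)) ?_ ?_)
      (Intertwines.mul (b := f) ?_ ?_)
    all_goals first
      | exact Legs.intertwines_assocInv q (by simp [Legs, L])
      | exact q.intertwines_assocInv_self (by simp [L]) (by simp [L]) (by simp [L])
      | exact q.intertwines_assocInv_self (by simp [L']) (by simp [L']) (by simp [L'])
  generalize q.assocInv b c d = b1, q.assoc a b (q.star c d) = a1 at *
  rw [mul_assoc (b1 * a1), e1]
  simp only [mul_assoc] at *
  rw [← n2, ← mul_assoc a1, ← mul_assoc b1, n1]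
  simp only [mul_assoc] at *
  congr 1
  rw [← mul_assoc a1, e2]
  simp only [mul_assoc]
  rw [← mul_assoc b1, n3, mul_assoc]
  congr 1
  rw [← mul_assoc (q.assoc a b (q.star (q.star c d) e)), ← n4, mul_assoc, e4]
  have e3' : ∀ x, b1 * (q.assocInv b (q.star c d) e * (q.assocInv c d e * x)) =
      q.assocInv (q.star b c) d e * (q.assocInv b c (q.star d e) * x) := by
    intro x
    rw [← mul_assoc (q.assocInv (q.star b c) d e), e3]
    simp only [mul_assoc]
  have n5' : ∀ x, q.assocInv (q.star b c) d e * (q.assocInv b c (q.star d e) *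
        (q.assocInv a (q.star b (q.star c (q.star d e))) f * x)) =
      q.assocInv a (q.star (q.star (q.star b c) d) e) f *
        (q.assocInv (q.star b c) d e * (q.assocInv b c (q.star d e) * x)) := by
    intro x
    have := congrArg (· * x) n5
    simpa only [mul_assoc] using this
  rw [e3', n5']

variable {N : R →ₗ[k] M}

lemma LeftCollapse.trans (h : LeftCollapse N a b) (h' : LeftCollapse N b c) :
    LeftCollapse N a c := fun x X => (h x X).trans (h' x X)

lemma RightCollapse.trans (h : RightCollapse N a b) (h' : RightCollapse N b c) :
    RightCollapse N a c := fun x X => (h x X).trans (h' x X)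

lemma LeftCollapse.conj (h : LeftCollapse N a q.unitLeg) {u : R} (hu : Intertwines u a a)
    (v : R) : LeftCollapse (N ∘ₗ LinearMap.mulLeft k u ∘ₗ LinearMap.mulRight k v) a q.unitLeg := by
  intro x X
  have e1 : u * (a x * X * v) = a x * (u * X * v) := by
    rw [mul_assoc (a x), ← mul_assoc u, hu]
    simp only [mul_assoc]
  have e2 : u * (q.unitLeg x * X * v) = q.unitLeg x * (u * X * v) := by
    rw [mul_assoc (q.unitLeg x), ← mul_assoc u, unitLeg_apply, ← Algebra.commutes]
    simp only [mul_assoc]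
  simp [e1, e2, h x]

lemma RightCollapse.conj (h : RightCollapse N a q.unitLeg) {v : R} (hv : Intertwines v a a)
    (u : R) :
    RightCollapse (N ∘ₗ LinearMap.mulLeft k u ∘ₗ LinearMap.mulRight k v) a q.unitLeg := by
  intro x X
  have e1 : u * (X * a x * v) = u * X * v * a x := by
    simp only [mul_assoc, hv x]
  have e2 : u * (X * q.unitLeg x * v) = u * X * v * q.unitLeg x := by
    simp only [mul_assoc, unitLeg_apply, Algebra.commutes]
  simp [e1, e2, h x]

lemma Legs.collapse_six (L : Legs [a, b, c, d, e, f])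
    (hbc : LeftCollapse N (q.star b c) q.unitLeg) (had : LeftCollapse N (q.star a d) q.unitLeg)
    (hde : RightCollapse N (q.star d e) q.unitLeg)
    (hcf : RightCollapse N (q.star c f) q.unitLeg) :
    N (q.assocInv b c d * q.assoc a b (q.star c d) *
        q.assocInv (q.star a b) (q.star c d) (q.star e f) *
        q.assoc (q.star c d) e f * q.assocInv c d e) =
      N (q.assocInv a d e * q.assocInv b c f) := by
  rw [L.six_coherence q]
  have L' := L.reverse
  simp only [Legs, List.reverse_cons, List.reverse_nil, List.nil_append, List.cons_append,
    List.pairwise_cons, List.forall_mem_cons] at L L'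
  have hxd : LeftCollapse N (q.star (q.star b c) d) d := by
    simpa using hbc.star q (LeftCollapse.refl (a := d)) (by simp) (by simp)
  have haxd : LeftCollapse N (q.star a (q.star (q.star b c) d)) q.unitLeg :=
    ((LeftCollapse.refl (a := a)).star q hxd (by simp [L]) (by simp [L])).trans had
  have hcde : RightCollapse N (q.star c (q.star d e)) c := by
    simpa using (RightCollapse.refl (a := c)).star q hde (by simp) (by simp)
  have hcdef : RightCollapse N (q.star (q.star c (q.star d e)) f) q.unitLeg :=
    (hcde.star q (RightCollapse.refl (a := f)) (by simp [L]) (by simp [L])).trans hcf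
  rw [RightCollapse.assoc q .refl .refl hcdef (by simp [L]) (by simp [L]) (by simp) (by simp)
      (by simp) (by simp),
    q.assoc_unitLeg_right (by simp [L]) (by simp [L]) (by simp [L]), mul_one,
    RightCollapse.assocInv q .refl hcde .refl (by simp [L]) (by simp [L]) (by simp [L])
      (by simp [L]) (by simp [L]) (by simp [L])]
  simp only [mul_assoc]
  rw [LeftCollapse.assoc q haxd .refl .refl (by simp) (by simp) (by simp) (by simp) (by simp [L])
      (by simp [L]),
    q.assoc_unitLeg_left (by simp [L]) (by simp [L]) (by simp [L]), one_mul,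
    LeftCollapse.assocInv q .refl hxd .refl (by simp [L]) (by simp [L]) (by simp [L])
      (by simp [L]) (by simp [L]) (by simp [L])]
  set N' := N ∘ₗ LinearMap.mulLeft k (q.assocInv a d e) ∘ₗ
    LinearMap.mulRight k (q.assocInv b c f) with hN'
  have left : LeftCollapse N' (q.star b c) q.unitLeg :=
    hbc.conj q (q.intertwines_assocInv_self (by simp [L]) (by simp [L']) (by simp [L'])) _
  have right : RightCollapse N' (q.star d e) q.unitLeg :=
    hde.conj q (q.intertwines_assocInv_self (by simp [L]) (by simp [L]) (by simp [L'])) _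
  have left' : LeftCollapse (N' ∘ₗ LinearMap.mulLeft k (q.assocInv a (q.star d e) f) ∘ₗ
      LinearMap.mulRight k (1 : R)) (q.star b c) q.unitLeg :=
    left.conj q (q.intertwines_assocInv_self (by simp [L]) (by simp [L']) (by simp [L'])) _
  have hxde : LeftCollapse N' (q.star (q.star (q.star b c) d) e) (q.star d e) := by
    have h : LeftCollapse N' (q.star (q.star b c) d) d := by
      simpa using left.star q (LeftCollapse.refl (a := d)) (by simp) (by simp)
    exact h.star q .refl (by simp [L]) (by simp [L])
  have key : N' (q.assocInv a (q.star (q.star (q.star b c) d) e) f *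
      (q.assocInv (q.star b c) d e * q.assocInv b c (q.star d e))) = N' 1 := by
    rw [LeftCollapse.assocInv q (a := a) (c := f) .refl hxde .refl
      (.star_right q (by simp [L]) (by simp [L])) (by simp [L]) (by simp [L]) (by simp [L])
      (by simp [L]) (by simp [L])]
    have h := LeftCollapse.assocInv q left' .refl .refl (by simp) (by simp) (by simp) (by simp)
      (by simp [L]) (by simp [L]) (b := d) (c := e) (X := q.assocInv b c (q.star d e))
    rw [q.assocInv_unitLeg_left (by simp [L]) (by simp [L]) (by simp [L]), one_mul] at h
    simp only [LinearMap.comp_apply _ (_ ∘ₗ _), LinearMap.comp_apply (LinearMap.mulLeft _ _),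
      LinearMap.mulLeft_apply, LinearMap.mulRight_apply, mul_one] at h
    rw [h, RightCollapse.assocInv q .refl .refl right (by simp [L]) (by simp [L]) (by simp)
        (by simp) (by simp) (by simp),
      q.assocInv_unitLeg_right (by simp [L]) (by simp [L]) (by simp [L]), mul_one,
      ← one_mul (q.assocInv a (q.star d e) f),
      RightCollapse.assocInv q .refl right .refl (by simp) (by simp) (by simp [L])
        (by simp [L]) (by simp [L]) (by simp),
      q.assocInv_unitLeg_mid (by simp [L]) (by simp [L]) (by simp [L]), mul_one]
  simpa [N', mul_assoc] using key

end Coherence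

/-- Linear maps into a `k`-algebra, with the module structure read off from the ring. -/
abbrev LegMap (k H R : Type) [Field k] [Ring H] [Algebra k H] [Ring R] [Algebra k R] : Type :=
  H →ₗ[k] R

section Abstract

variable {k H R M : Type} [Field k] [Ring H] [Algebra k H] (q : QuasiHopf k H)
  [Ring R] [Algebra k R] [AddCommGroup M] [Module k M] {a b c d : H →ₗ[k] R}

lemma map_star_mul (N : R →ₗ[k] M) (h : H) (X : R) :
    N (q.star a b h * X) =
      ∑ i ∈ Finset.range (q.n h), N (a (q.d1 h i) * (b (q.d2 h i) * X)) := by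
  simp only [star_apply, Finset.sum_mul, map_sum, mul_assoc]

lemma map_mul_star (N : R →ₗ[k] M) (h : H) (X : R) :
    N (X * q.star a b h) =
      ∑ i ∈ Finset.range (q.n h), N (X * a (q.d1 h i) * b (q.d2 h i)) := by
  simp only [star_apply, Finset.mul_sum, map_sum, mul_assoc]

lemma map_unitLeg_mul (N : R →ₗ[k] M) (h : H) (X : R) :
    N (q.unitLeg h * X) = q.counit h • N X := by
  rw [unitLeg_apply, ← Algebra.smul_def, map_smul]

lemma Legs.assocInv_pentagon (L : Legs [a, b, c, d]) :
    q.assocInv a b c = q.assocInv (q.star a b) c d *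
      (q.assocInv a b (q.star c d) * (q.assoc b c d * q.assoc a (q.star b c) d)) := by
  have pent := (L.pentagon_forms q).2.2
  simp only [Legs, List.pairwise_cons, List.forall_mem_cons] at L
  have inv1 : q.assocInv a (q.star b c) d * q.assoc a (q.star b c) d = 1 :=
    Legs.assocInv_mul_assoc q (by simp [Legs, L])
  have inv2 : q.assocInv b c d * q.assoc b c d = 1 :=
    Legs.assocInv_mul_assoc q (by simp [Legs, L])
  rw [← mul_assoc, pent, mul_assoc, ← mul_assoc (q.assocInv b c d), inv2, one_mul, mul_assoc,
    inv1, mul_one]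

end Abstract

section Inclusions

variable {k H A B M P : Type} [Field k] [Ring H] [Algebra k H] (q : QuasiHopf k H)
  [Ring A] [Algebra k A] [Ring B] [Algebra k B] [AddCommGroup M] [Module k M]
  [AddCommGroup P] [Module k P]

/-- `x ↦ x ⊗ 1` -/
def inl : A →ₗ[k] A ⊗[k] B := (TensorProduct.mk k A B).flip 1

/-- `y ↦ 1 ⊗ y` -/
def inr : B →ₗ[k] A ⊗[k] B := TensorProduct.mk k A B 1

@[simp]
lemma inl_apply (x : A) : inl (k := k) (B := B) x = x ⊗ₜ[k] 1 := rfl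

@[simp]
lemma inr_apply (y : B) : inr (k := k) (A := A) y = 1 ⊗ₜ[k] y := rfl

@[simp]
lemma isHom_id : IsHom (LinearMap.id : A →ₗ[k] A) := ⟨rfl, fun _ _ => rfl⟩

@[simp]
lemma isHom_inl : IsHom (inl : A →ₗ[k] A ⊗[k] B) := ⟨rfl, by simp⟩

@[simp]
lemma isHom_inr : IsHom (inr : B →ₗ[k] A ⊗[k] B) := ⟨rfl, by simp⟩

@[simp]
lemma IsHom.inl_comp {a : H →ₗ[k] A} (ha : IsHom a) :
    IsHom ((inl : A →ₗ[k] A ⊗[k] B) ∘ₗ a) :=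
  ⟨by simp [ha.one, Algebra.TensorProduct.one_def], by simp [ha.mul]⟩

@[simp]
lemma IsHom.inr_comp {b : H →ₗ[k] B} (hb : IsHom b) :
    IsHom ((inr : B →ₗ[k] A ⊗[k] B) ∘ₗ b) :=
  ⟨by simp [hb.one, Algebra.TensorProduct.one_def], by simp [hb.mul]⟩

@[simp]
lemma commuting_inl_inr {a : H →ₗ[k] A} {b : H →ₗ[k] B} :
    Commuting ((inl : A →ₗ[k] A ⊗[k] B) ∘ₗ a) ((inr : B →ₗ[k] A ⊗[k] B) ∘ₗ b) :=
  fun x y => by simp [Commute, SemiconjBy]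

@[simp]
lemma commuting_inr_inl {a : H →ₗ[k] A} {b : H →ₗ[k] B} :
    Commuting ((inr : B →ₗ[k] A ⊗[k] B) ∘ₗ b) ((inl : A →ₗ[k] A ⊗[k] B) ∘ₗ a) :=
  commuting_inl_inr.symm

@[simp]
lemma Commuting.inl_comp {a b : H →ₗ[k] A} (h : Commuting a b) :
    Commuting ((inl : A →ₗ[k] A ⊗[k] B) ∘ₗ a) ((inl : A →ₗ[k] A ⊗[k] B) ∘ₗ b) :=
  fun x y => by simp [Commute, SemiconjBy, (h x y).eq]

@[simp]
lemma Commuting.inr_comp {a b : H →ₗ[k] B} (h : Commuting a b) :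
    Commuting ((inr : B →ₗ[k] A ⊗[k] B) ∘ₗ a) ((inr : B →ₗ[k] A ⊗[k] B) ∘ₗ b) :=
  fun x y => by simp [Commute, SemiconjBy, (h x y).eq]

lemma star_inl_comp (a b : H →ₗ[k] A) :
    q.star ((inl : A →ₗ[k] A ⊗[k] B) ∘ₗ a) (inl ∘ₗ b) = inl ∘ₗ q.star a b := by
  ext h
  simp [star_apply]

lemma star_inr_comp (a b : H →ₗ[k] B) :
    q.star ((inr : B →ₗ[k] A ⊗[k] B) ∘ₗ a) (inr ∘ₗ b) = inr ∘ₗ q.star a b := by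
  ext h
  simp [star_apply]

lemma inl_comp_unitLeg :
    (inl : A →ₗ[k] A ⊗[k] B) ∘ₗ q.unitLeg = q.unitLeg := by
  ext h
  simp [unitLeg_apply, Algebra.TensorProduct.algebraMap_apply]

lemma inr_comp_unitLeg :
    (inr : B →ₗ[k] A ⊗[k] B) ∘ₗ q.unitLeg = q.unitLeg := by
  ext h
  simp [unitLeg_apply, Algebra.algebraMap_eq_smul_one, Algebra.TensorProduct.one_def]

lemma LeftCollapse.map_inl {N : A →ₗ[k] M} {a a' : H →ₗ[k] A} (h : LeftCollapse N a a')
    (N' : B →ₗ[k] P) : LeftCollapse (TensorProduct.map N N') (inl ∘ₗ a) (inl ∘ₗ a') := by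
  intro x X
  induction X using TensorProduct.induction_on with
  | zero => simp
  | add X Y hX hY => simp only [mul_add, map_add, hX, hY]
  | tmul y z => simp [h x y]

lemma LeftCollapse.map_inr {N : B →ₗ[k] M} {a a' : H →ₗ[k] B} (h : LeftCollapse N a a')
    (N' : A →ₗ[k] P) : LeftCollapse (TensorProduct.map N' N) (inr ∘ₗ a) (inr ∘ₗ a') := by
  intro x X
  induction X using TensorProduct.induction_on with
  | zero => simp
  | add X Y hX hY => simp only [mul_add, map_add, hX, hY]
  | tmul y z => simp [h x z]

lemma RightCollapse.map_inl {N : A →ₗ[k] M} {a a' : H →ₗ[k] A} (h : RightCollapse N a a')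
    (N' : B →ₗ[k] P) : RightCollapse (TensorProduct.map N N') (inl ∘ₗ a) (inl ∘ₗ a') := by
  intro x X
  induction X using TensorProduct.induction_on with
  | zero => simp
  | add X Y hX hY => simp only [add_mul, map_add, hX, hY]
  | tmul y z => simp [h x y]

lemma RightCollapse.map_inr {N : B →ₗ[k] M} {a a' : H →ₗ[k] B} (h : RightCollapse N a a')
    (N' : A →ₗ[k] P) : RightCollapse (TensorProduct.map N' N) (inr ∘ₗ a) (inr ∘ₗ a') := by
  intro x X
  induction X using TensorProduct.induction_on with
  | zero => simp
  | add X Y hX hY => simp only [add_mul, map_add, hX, hY]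
  | tmul y z => simp [h x z]

lemma LeftCollapse.comp {N : A →ₗ[k] M} {a a' : H →ₗ[k] A} (h : LeftCollapse N a a')
    (g : M →ₗ[k] P) : LeftCollapse (g ∘ₗ N) a a' :=
  fun x X => congrArg g (h x X)

lemma RightCollapse.comp {N : A →ₗ[k] M} {a a' : H →ₗ[k] A} (h : RightCollapse N a a')
    (g : M →ₗ[k] P) : RightCollapse (g ∘ₗ N) a a' :=
  fun x X => congrArg g (h x X)

end Inclusions

section Uniqueness

variable {k H A : Type} [Field k] [Ring H] [Algebra k H] (q : QuasiHopf k H)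
  [Ring A] [Algebra k A]

/-- `x ⊗ y ⊗ z ↦ s x * α * D y * β * s' z` -/
def sandwich (s : H →ₗ[k] A) (α : A) (D : H →ₗ[k] A) (β : A) (s' : H →ₗ[k] A) :
    H ⊗[k] (H ⊗[k] H) →ₗ[k] A :=
  join (LinearMap.mulRight k α ∘ₗ s) (join (LinearMap.mulRight k β ∘ₗ D) s')

@[simp]
lemma sandwich_tmul (s : H →ₗ[k] A) (α : A) (D : H →ₗ[k] A) (β : A) (s' : H →ₗ[k] A)
    (x y z : H) :
    sandwich s α D β s' (x ⊗ₜ[k] (y ⊗ₜ[k] z)) = s x * α * (D y * β * s' z) := by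
  simp [sandwich]

/-- The first leg of `H ⊗ H ⊗ H`. -/
def leg₁ : H →ₗ[k] H ⊗[k] (H ⊗[k] H) := inl

/-- The second leg of `H ⊗ H ⊗ H`. -/
def leg₂ : H →ₗ[k] H ⊗[k] (H ⊗[k] H) := inr ∘ₗ inl

/-- The third leg of `H ⊗ H ⊗ H`. -/
def leg₃ : H →ₗ[k] H ⊗[k] (H ⊗[k] H) := inr ∘ₗ inr

lemma leg₁_apply (h : H) : leg₁ (k := k) h = h ⊗ₜ[k] (1 ⊗ₜ[k] 1) := rfl

lemma leg₂_apply (h : H) : leg₂ (k := k) h = 1 ⊗ₜ[k] (h ⊗ₜ[k] 1) := rfl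

lemma leg₃_apply (h : H) : leg₃ (k := k) h = 1 ⊗ₜ[k] (1 ⊗ₜ[k] h) := rfl

lemma legs_three : Legs [leg₁ (k := k) (H := H), leg₂, leg₃] := by
  have h1 : ∀ b : H →ₗ[k] H ⊗[k] H,
      Commuting (inl : H →ₗ[k] H ⊗[k] (H ⊗[k] H)) (inr ∘ₗ b) :=
    fun b => commuting_inl_inr (a := LinearMap.id) (b := b)
  have h2 : Commuting (inl : H →ₗ[k] H ⊗[k] H) (inr : H →ₗ[k] H ⊗[k] H) :=
    commuting_inl_inr (a := LinearMap.id) (b := LinearMap.id)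
  simp [Legs, leg₁, leg₂, leg₃, h1, h2]

lemma assocInv_legs : q.assocInv leg₁ leg₂ leg₃ = q.PhiInv := by
  simp [assocInv_eq, PhiInv, leg₁_apply, leg₂_apply, leg₃_apply]

lemma tensor_three_induction {p : H ⊗[k] (H ⊗[k] H) → Prop} (zero : p 0)
    (add : ∀ X Y, p X → p Y → p (X + Y)) (tmul : ∀ x y z, p (x ⊗ₜ[k] (y ⊗ₜ[k] z)))
    (X : H ⊗[k] (H ⊗[k] H)) : p X := by
  induction X using TensorProduct.induction_on with
  | zero => exact zero
  | add X Y hX hY => exact add X Y hX hY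
  | tmul x Y =>
    induction Y using TensorProduct.induction_on with
    | zero => simpa using zero
    | add Y Z hY hZ => rw [TensorProduct.tmul_add]; exact add _ _ hY hZ
    | tmul y z => exact tmul x y z

variable {s s' D : H →ₗ[k] A} {α β : A}

lemma leftCollapse_sandwich (hs : ∀ x y, s (x * y) = s y * s x) (hD : IsHom D)
    (hα : ∀ h, ∑ i ∈ Finset.range (q.n h), s (q.d1 h i) * α * D (q.d2 h i) = q.counit h • α) :
    LeftCollapse (sandwich s α D β s') (q.star leg₁ leg₂) q.unitLeg := by
  intro h X
  induction X using tensor_three_induction with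
  | zero => simp
  | add X Y hX hY => simp only [mul_add, map_add, hX, hY]
  | tmul x y z =>
    have e := congrArg (fun w => s x * w * (D y * β * s' z)) (hα h)
    simp only [Finset.mul_sum, Finset.sum_mul] at e
    simp only [star_apply, Finset.sum_mul, map_sum, leg₁_apply, leg₂_apply, unitLeg_apply,
      Algebra.TensorProduct.tmul_mul_tmul, one_mul, mul_one, sandwich_tmul, hs, hD.mul,
      ← Algebra.smul_def, map_smul]
    simp only [mul_assoc, smul_mul_assoc, mul_smul_comm] at e ⊢
    exact e

lemma rightCollapse_sandwich (hs' : ∀ x y, s' (x * y) = s' y * s' x) (hD : IsHom D)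
    (hβ : ∀ h, ∑ i ∈ Finset.range (q.n h), D (q.d1 h i) * β * s' (q.d2 h i) = q.counit h • β) :
    RightCollapse (sandwich s α D β s') (q.star leg₂ leg₃) q.unitLeg := by
  intro h X
  induction X using tensor_three_induction with
  | zero => simp
  | add X Y hX hY => simp only [add_mul, map_add, hX, hY]
  | tmul x y z =>
    have e := congrArg (fun w => s x * α * (D y * w * s' z)) (hβ h)
    simp only [Finset.mul_sum, Finset.sum_mul] at e
    simp only [star_apply, Finset.mul_sum, map_sum, leg₃_apply, leg₂_apply, unitLeg_apply,
      Algebra.TensorProduct.tmul_mul_tmul, one_mul, mul_one, sandwich_tmul, hs', hD.mul,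
      ← Algebra.commutes, ← Algebra.smul_def, map_smul]
    simp only [mul_assoc, smul_mul_assoc, mul_smul_comm] at e ⊢
    exact e

lemma sandwich_mul_leg₁ (hs : ∀ x y, s (x * y) = s y * s x) (h : H) (X : H ⊗[k] (H ⊗[k] H)) :
    sandwich s α D β s' (X * leg₁ h) = s h * sandwich s α D β s' X := by
  induction X using tensor_three_induction with
  | zero => simp
  | add X Y hX hY => simp only [add_mul, mul_add, map_add, hX, hY]
  | tmul x y z => simp [leg₁_apply, hs, mul_assoc]

lemma sandwich_leg₃_mul (hs' : ∀ x y, s' (x * y) = s' y * s' x) (h : H)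
    (X : H ⊗[k] (H ⊗[k] H)) :
    sandwich s α D β s' (leg₃ h * X) = sandwich s α D β s' X * s' h := by
  induction X using tensor_three_induction with
  | zero => simp
  | add X Y hX hY => simp only [add_mul, mul_add, map_add, hX, hY]
  | tmul x y z => simp [leg₃_apply, hs', mul_assoc]

lemma leftCollapse_join {R : Type} [Ring R] [Algebra k R] {F : R →ₗ[k] A} {a : H →ₗ[k] R}
    (hD : IsHom D) (hF : ∀ h X, F (a h * X) = F X * s' h)
    (hα : ∀ h, ∑ i ∈ Finset.range (q.n h), s' (q.d1 h i) * α * D (q.d2 h i) = q.counit h • α) :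
    LeftCollapse (join F (LinearMap.mulLeft k α ∘ₗ D)) (q.star (inl ∘ₗ a) (inr ∘ₗ LinearMap.id))
      q.unitLeg := by
  intro h X
  induction X using TensorProduct.induction_on with
  | zero => simp
  | add X Y hX hY => simp only [mul_add, map_add, hX, hY]
  | tmul X w =>
    have e := congrArg (fun y => F X * y * D w) (hα h)
    simp only [Finset.mul_sum, Finset.sum_mul] at e
    simp only [map_star_mul, map_unitLeg_mul, LinearMap.comp_apply, LinearMap.id_apply,
      inl_apply, inr_apply, Algebra.TensorProduct.tmul_mul_tmul, one_mul, join_tmul,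
      LinearMap.mulLeft_apply, hD.mul, hF]
    simp only [mul_assoc, smul_mul_assoc, mul_smul_comm] at e ⊢
    exact e

/-- The comparison element of two antipodes intertwines them. -/
lemma sandwich_phiInv_mul (hs : ∀ x y, s (x * y) = s y * s x)
    (hs' : ∀ x y, s' (x * y) = s' y * s' x) (hD : IsHom D)
    (hα : ∀ h, ∑ i ∈ Finset.range (q.n h), s (q.d1 h i) * α * D (q.d2 h i) = q.counit h • α)
    (hβ : ∀ h, ∑ i ∈ Finset.range (q.n h), D (q.d1 h i) * β * s' (q.d2 h i) = q.counit h • β)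
    (h : H) :
    sandwich s α D β s' q.PhiInv * s' h = s h * sandwich s α D β s' q.PhiInv := by
  have left := q.leftCollapse_sandwich (s' := s') (β := β) hs hD hα
  have right := q.rightCollapse_sandwich (s := s) (α := α) hs' hD hβ
  have L := legs_three (k := k) (H := H)
  have e := (L.intertwines_assocInv q) h
  have left' := (left.star q (LeftCollapse.refl (a := leg₃)) (by simp) (by simp)) h
  have right' := ((RightCollapse.refl (a := leg₁)).star q right (by simp) (by simp)) h
  simp only [star_unitLeg_left, star_unitLeg_right] at left' right'
  rw [← sandwich_leg₃_mul hs', ← left', ← sandwich_mul_leg₁ hs, ← right', ← assocInv_legs, e]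

/-- The comparison element of two antipodes carries one `α` to the other. -/
lemma sandwich_phiInv_mul_alpha {α' : A} (hs : ∀ x y, s (x * y) = s y * s x) (hs1 : s 1 = 1)
    (hs' : ∀ x y, s' (x * y) = s' y * s' x) (hD : IsHom D)
    (hα : ∀ h, ∑ i ∈ Finset.range (q.n h), s (q.d1 h i) * α * D (q.d2 h i) = q.counit h • α)
    (hβ : ∀ h, ∑ i ∈ Finset.range (q.n h), D (q.d1 h i) * β * s' (q.d2 h i) = q.counit h • β)
    (hα' : ∀ h,
      ∑ i ∈ Finset.range (q.n h), s' (q.d1 h i) * α' * D (q.d2 h i) = q.counit h • α')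
    (nondeg : ∑ a ∈ Finset.range q.np,
      D (q.P1 a) * β * s' (q.P2 a) * α' * D (q.P3 a) = 1) :
    sandwich s α D β s' q.PhiInv * α' = α := by
  set F := sandwich s α D β s'
  let G : (H ⊗[k] (H ⊗[k] H)) ⊗[k] H →ₗ[k] A := join F (LinearMap.mulLeft k α' ∘ₗ D)
  let e1 : LegMap k H ((H ⊗[k] (H ⊗[k] H)) ⊗[k] H) := inl ∘ₗ leg₁
  let e2 : LegMap k H ((H ⊗[k] (H ⊗[k] H)) ⊗[k] H) := inl ∘ₗ leg₂
  let e3 : LegMap k H ((H ⊗[k] (H ⊗[k] H)) ⊗[k] H) := inl ∘ₗ leg₃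
  let e4 : LegMap k H ((H ⊗[k] (H ⊗[k] H)) ⊗[k] H) := inr ∘ₗ LinearMap.id
  have L : Legs [e1, e2, e3, e4] := by
    have h4 : ∀ a : H →ₗ[k] H ⊗[k] (H ⊗[k] H),
        Commuting (inl ∘ₗ a) (inr : H →ₗ[k] (H ⊗[k] (H ⊗[k] H)) ⊗[k] H) :=
      fun a => commuting_inl_inr (a := a) (b := LinearMap.id)
    have L := legs_three (k := k) (H := H)
    simp only [Legs, List.pairwise_cons, List.forall_mem_cons] at L
    simp [Legs, e1, e2, e3, e4, L, h4]
  have h12 : LeftCollapse G (q.star e1 e2) q.unitLeg := by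
    simp only [e1, e2]
    rw [star_inl_comp, ← inl_comp_unitLeg]
    exact ((q.leftCollapse_sandwich hs hD hα).map_inl _).comp _
  have h23 : RightCollapse G (q.star e2 e3) q.unitLeg := by
    simp only [e3, e2]
    rw [star_inl_comp, ← inl_comp_unitLeg]
    exact ((q.rightCollapse_sandwich hs' hD hβ).map_inl _).comp _
  have h34 : LeftCollapse G (q.star e3 e4) q.unitLeg := by
    exact q.leftCollapse_join hD (sandwich_leg₃_mul hs') hα'
  have main := L.assocInv_pentagon q
  have L' := L
  simp only [Legs, List.pairwise_cons, List.forall_mem_cons] at L'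
  have hG := congrArg G main
  rw [LeftCollapse.assocInv q h12 .refl .refl (by simp) (by simp) (by simp) (by simp)
      (by simp [L']) (by simp [L']),
    q.assocInv_unitLeg_left (by simp [L']) (by simp [L']) (by simp [L']), one_mul,
    LeftCollapse.assocInv q .refl .refl h34 (by simp [L']) (by simp [L']) (by simp [L'])
      (by simp) (by simp [L']) (by simp),
    q.assocInv_unitLeg_right (by simp [L']) (by simp [L']) (by simp [L']), one_mul,
    RightCollapse.assoc q .refl h23 .refl (by simp) (by simp) (by simp [L'])
      (by simp [L']) (by simp [L']) (by simp),
    q.assoc_unitLeg_mid (by simp [L']) (by simp [L']), mul_one] at hG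
  have l : G (q.assocInv e1 e2 e3) = F q.PhiInv * α' := by
    rw [← assocInv_legs, assocInv_eq, assocInv_eq]
    simp only [e1, e2, e3, LinearMap.comp_apply, inl_apply, Algebra.TensorProduct.tmul_mul_tmul,
      one_mul, ← TensorProduct.sum_tmul]
    simp [G, hD.one]
  have r : G (q.assoc e2 e3 e4) = α := by
    rw [assoc_eq]
    have e := congrArg (fun y => α * y) nondeg
    simp only [Finset.mul_sum, mul_one] at e
    simp only [e4, e2, e3, LinearMap.comp_apply, inl_apply, inr_apply, leg₂_apply, leg₃_apply,
      Algebra.TensorProduct.tmul_mul_tmul, one_mul, mul_one, map_sum, LinearMap.id_apply, G,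
      join_tmul, LinearMap.mulLeft_apply, F, sandwich_tmul, hs1]
    simp only [mul_assoc] at e ⊢
    exact e
  rw [← l, hG, r]

end Uniqueness

section Expansion

variable {k H R M : Type} [Field k] [Ring H] [Algebra k H] (q : QuasiHopf k H)
  [Ring R] [Algebra k R] [AddCommGroup M] [Module k M] {a b c d e f : H →ₗ[k] R}

lemma Legs.assocInv_mul_assoc_eq_sum (L : Legs [a, b, c, d]) :
    q.assocInv b c d * q.assoc a b (q.star c d) =
      ∑ i ∈ Finset.range q.np, ∑ j ∈ Finset.range q.nq, ∑ m ∈ Finset.range (q.n (q.P3 i)),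
        a (q.P1 i) * (b (q.Q1 j * q.P2 i) * (c (q.Q2 j * q.d1 (q.P3 i) m) *
          d (q.Q3 j * q.d2 (q.P3 i) m))) := by
  simp only [Legs, List.pairwise_cons, List.forall_mem_cons] at L
  have hcd : IsHom (join c d) := L.1.2.2.1.join L.1.2.2.2.1 (by simp [L])
  have hbcd : IsHom (join b (join c d)) :=
    L.1.2.1.join hcd (Commuting.join_right (by simp [L]) (by simp [L]))
  have hom : IsHom (join a (join b (join c d))) := L.1.1.join hbcd
    (Commuting.join_right (by simp [L]) (Commuting.join_right (by simp [L]) (by simp [L])))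
  have term : ∀ x y z w y' z' w', b y * (c z * d w) * (a x * (b y' * (c z' * d w'))) =
      a x * (b (y * y') * (c (z * z') * d (w * w'))) := by
    intro x y z w y' z' w'
    have e := hom.mul (1 ⊗ₜ (y ⊗ₜ (z ⊗ₜ w))) (x ⊗ₜ (y' ⊗ₜ (z' ⊗ₜ w')))
    simpa [L.1.1.one] using e.symm
  simp only [assocInv_eq, assoc_eq, star_apply, Finset.sum_mul, Finset.mul_sum, term]
  exact Finset.sum_congr rfl fun i _ => Finset.sum_comm

lemma Legs.assoc_mul_assocInv_eq_sum (L : Legs [c, d, e, f]) :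
    q.assoc (q.star c d) e f * q.assocInv c d e =
      ∑ i ∈ Finset.range q.np, ∑ j ∈ Finset.range q.nq, ∑ m ∈ Finset.range (q.n (q.P1 i)),
        c (q.d1 (q.P1 i) m * q.Q1 j) * (d (q.d2 (q.P1 i) m * q.Q2 j) *
          (e (q.P2 i * q.Q3 j) * f (q.P3 i))) := by
  simp only [Legs, List.pairwise_cons, List.forall_mem_cons] at L
  have hef : IsHom (join e f) := L.1.2.2.1.join L.1.2.2.2.1 (by simp [L])
  have hdef : IsHom (join d (join e f)) :=
    L.1.2.1.join hef (Commuting.join_right (by simp [L]) (by simp [L]))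
  have hom : IsHom (join c (join d (join e f))) := L.1.1.join hdef
    (Commuting.join_right (by simp [L]) (Commuting.join_right (by simp [L]) (by simp [L])))
  have term : ∀ x y z w x' y' z', c x * d y * (e z * f w) * (c x' * (d y' * e z')) =
      c (x * x') * (d (y * y') * (e (z * z') * f w)) := by
    intro x y z w x' y' z'
    have e := hom.mul (x ⊗ₜ (y ⊗ₜ (z ⊗ₜ w))) (x' ⊗ₜ (y' ⊗ₜ (z' ⊗ₜ 1)))
    simpa [L.1.2.2.2.1.one, mul_assoc] using e.symm
  simp only [assocInv_eq, assoc_eq, star_apply, Finset.sum_mul, Finset.mul_sum, term]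
  rw [Finset.sum_comm]

lemma Legs.collapse_four (L : Legs [a, b, c, d]) {N : R →ₗ[k] M}
    (hbc : LeftCollapse N (q.star b c) q.unitLeg) (had : LeftCollapse N (q.star a d) q.unitLeg)
    (h : H) :
    N (q.assocInv b c d * q.assoc a b (q.star c d) * q.star (q.star a b) (q.star c d) h) =
      q.counit h • N (q.assocInv b c d * q.assoc a b (q.star c d)) := by
  have L' := L.reverse
  simp only [Legs, List.reverse_cons, List.reverse_nil, List.nil_append, List.cons_append,
    List.pairwise_cons, List.forall_mem_cons] at L L'
  have int1 : Intertwines (q.assoc a b (q.star c d)) (q.star (q.star a b) (q.star c d))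
      (q.star a (q.star b (q.star c d))) := Legs.intertwines_assoc q (by simp [Legs, L])
  have ibcd : Intertwines (q.assocInv b c d) (q.star b (q.star c d)) (q.star (q.star b c) d) :=
    Legs.intertwines_assocInv q (by simp [Legs, L])
  have ia : Intertwines (q.assocInv b c d) a a :=
    q.intertwines_assocInv_self (by simp [L']) (by simp [L']) (by simp [L'])
  have hxd : LeftCollapse N (q.star (q.star b c) d) d := by
    simpa using hbc.star q (LeftCollapse.refl (a := d)) (by simp) (by simp)
  have hall : LeftCollapse N (q.star a (q.star (q.star b c) d)) q.unitLeg :=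
    (LeftCollapse.star q .refl hxd
      (Commuting.star_right q (by simp [L]) (by simp [L])) (by simp [L])).trans had
  rw [((ia.star q ibcd).mul int1) h, hall, map_unitLeg_mul]

lemma map_middle_eq_sum (N : R →ₗ[k] M) (U V : R) :
    N (U * q.assocInv (q.star a b) (q.star c d) (q.star e f) * V) =
      ∑ r ∈ Finset.range q.nq, N (U * (join a b (q.comul (q.Q1 r)) *
        (join c d (q.comul (q.Q2 r)) * join e f (q.comul (q.Q3 r)))) * V) := by
  simp only [assocInv_eq, Finset.sum_mul, Finset.mul_sum, map_sum]
  rfl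

end Expansion

section Sswap

variable {k H : Type} [Field k] [Ring H] [Algebra k H] (q : QuasiHopf k H)

@[simp]
lemma sswap_tmul (x y : H) : q.sswap (x ⊗ₜ[k] y) = q.S y ⊗ₜ[k] q.S x := rfl

@[simp]
lemma sswapInv_tmul (x y : H) : q.sswapInv (x ⊗ₜ[k] y) = q.Sinv y ⊗ₜ[k] q.Sinv x := rfl

lemma sswap_mul (X Y : H ⊗[k] H) : q.sswap (X * Y) = q.sswap Y * q.sswap X := by
  induction X using TensorProduct.induction_on with
  | zero => simp
  | add X X' hX hX' => simp [add_mul, mul_add, hX, hX']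
  | tmul x x' =>
    induction Y using TensorProduct.induction_on with
    | zero => simp
    | add Y Y' hY hY' => simp [add_mul, mul_add, hY, hY']
    | tmul y y' => simp [q.S_mul]

lemma sswap_one : q.sswap 1 = 1 := by
  simp [Algebra.TensorProduct.one_def, q.S_one]

lemma sswap_sswapInv (X : H ⊗[k] H) : q.sswap (q.sswapInv X) = X := by
  induction X using TensorProduct.induction_on with
  | zero => simp
  | add X X' hX hX' => simp [hX, hX']
  | tmul x x' => simp [q.S_Sinv]

lemma scop_eq (x : H) : q.scop x = q.sswap (q.comul x) := by
  simp [scop, q.comul_eq]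

lemma scop_mul (x y : H) : q.scop (x * y) = q.scop y * q.scop x := by
  simp [scop_eq, sswap_mul]

end Sswap

section TwistElements

variable {k H T : Type} [Field k] [Ring H] [Algebra k H] (q : QuasiHopf k H)
  [Ring T] [Algebra k T]

lemma legs_inl_inr_four {u v : H →ₗ[k] T} (L : Legs [u, v]) :
    Legs [(inr : T →ₗ[k] T ⊗[k] T) ∘ₗ u, inl ∘ₗ u, inl ∘ₗ v, inr ∘ₗ v] := by
  simp only [Legs, List.pairwise_cons, List.forall_mem_cons] at L
  simp [Legs, L]

lemma legs_inl_inr_six {u v w : H →ₗ[k] T} (L : Legs [u, v, w]) :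
    Legs [(inr : T →ₗ[k] T ⊗[k] T) ∘ₗ u, inl ∘ₗ u, inl ∘ₗ v, inr ∘ₗ v, inr ∘ₗ w, inl ∘ₗ w] := by
  simp only [Legs, List.pairwise_cons, List.forall_mem_cons] at L
  simp [Legs, L]

lemma scop_mul_aEl_mul_comul_aux {u v : H →ₗ[k] T} (L : Legs [u, v]) {K : T →ₗ[k] H}
    (hu : ∀ y X, K (X * u y) = q.S y * K X) (hv : ∀ y X, K (X * v y) = K X * y)
    (h1 : K 1 = q.alpha) (hK : LeftCollapse K (q.star u v) q.unitLeg) (h : H) :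
    ∑ i ∈ Finset.range (q.n h), q.scop (q.d1 h i) * q.aEl * q.comul (q.d2 h i) =
      q.counit h • q.aEl := by
  have L4 := legs_inl_inr_four L
  have hu1 : ∀ y, K (u y) = q.S y * q.alpha := fun y => by simpa [h1] using hu y 1
  have link : ∀ (X : T ⊗[k] T) (Y Z : H ⊗[k] H),
      TensorProduct.map K K (X * join (inr ∘ₗ u) (inl ∘ₗ u) Y * join (inl ∘ₗ v) (inr ∘ₗ v) Z) =
        q.sswap Y * TensorProduct.map K K X * Z := by
    intro X Y Z
    induction X using TensorProduct.induction_on with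
    | zero => simp
    | add X X' hX hX' => simp only [add_mul, mul_add, map_add, hX, hX']
    | tmul x x' =>
      induction Y using TensorProduct.induction_on with
      | zero => simp
      | add Y Y' hY hY' => simp only [add_mul, mul_add, map_add, hY, hY']
      | tmul y y' =>
        induction Z using TensorProduct.induction_on with
        | zero => simp
        | add Z Z' hZ hZ' => simp only [mul_add, map_add, hZ, hZ']
        | tmul z z' => simp [hu, hv]
  have ha : TensorProduct.map K K (q.assocInv (inl ∘ₗ u) (inl ∘ₗ v) (inr ∘ₗ v) *
      q.assoc (inr ∘ₗ u) (inl ∘ₗ u) (q.star (inl ∘ₗ v) (inr ∘ₗ v))) = q.aEl := by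
    rw [L4.assocInv_mul_assoc_eq_sum q]
    simp only [map_sum, aEl]
    simp [hu1, hv, mul_assoc]
  have e := L4.collapse_four q (N := TensorProduct.map K K) (by
      rw [star_inl_comp, ← inl_comp_unitLeg]
      exact hK.map_inl K) (by
      rw [star_inr_comp, ← inr_comp_unitLeg]
      exact hK.map_inr K) h
  rw [map_mul_star, ha] at e
  rw [← e]
  refine Finset.sum_congr rfl fun i _ => ?_
  rw [← ha, scop_eq]
  exact (link _ _ _).symm

end TwistElements

section TwistInverse

variable {k H T : Type} [Field k] [Ring H] [Algebra k H] (q : QuasiHopf k H)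
  [Ring T] [Algebra k T]

lemma assocInv_inl_comp (a b c : H →ₗ[k] T) :
    q.assocInv ((inl : T →ₗ[k] T ⊗[k] T) ∘ₗ a) (inl ∘ₗ b) (inl ∘ₗ c) =
      inl (q.assocInv a b c) := by
  simp only [assocInv_eq, map_sum]
  simp

lemma assocInv_inr_comp (a b c : H →ₗ[k] T) :
    q.assocInv ((inr : T →ₗ[k] T ⊗[k] T) ∘ₗ a) (inr ∘ₗ b) (inr ∘ₗ c) =
      inr (q.assocInv a b c) := by
  simp only [assocInv_eq, map_sum]
  simp

lemma scop_aEl_comul_bEl_scop_aux {u v w : H →ₗ[k] T} (L : Legs [u, v, w]) {N : T →ₗ[k] H}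
    (hN : ∀ x y x' y' z y'' z', N (u x * (v y * (u x' * (v y' * (w z * (v y'' * w z')))))) =
      q.S x' * (q.S x * q.alpha * y) * y' * (y'' * q.beta * q.S z') * q.S z)
    (hl : LeftCollapse N (q.star u v) q.unitLeg) (hr : RightCollapse N (q.star v w) q.unitLeg)
    (hone : N (q.assocInv u v w) = 1) :
    ∑ r ∈ Finset.range q.nq, q.scop (q.Q1 r) * q.aEl * q.comul (q.Q2 r) * q.bEl *
      q.scop (q.Q3 r) = 1 := by
  have L6 := legs_inl_inr_six L
  have L4 : Legs [(inr : T →ₗ[k] T ⊗[k] T) ∘ₗ u, inl ∘ₗ u, inl ∘ₗ v, inr ∘ₗ v] :=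
    ⟨fun x hx => L6.1 x (by simp only [List.mem_cons] at hx ⊢; tauto), L6.2.sublist (by simp)⟩
  have L4' : Legs [(inl : T →ₗ[k] T ⊗[k] T) ∘ₗ v, inr ∘ₗ v, inr ∘ₗ w, inl ∘ₗ w] :=
    ⟨fun x hx => L6.1 x (by simp only [List.mem_cons] at hx ⊢; tauto), L6.2.sublist (by simp)⟩
  have link : ∀ (x₁ x₂ x₃ x₄ y₁ y₂ y₃ y₄ : H) (X Y Z : H ⊗[k] H),
      TensorProduct.map N N (((inr ∘ₗ u) x₁ * ((inl ∘ₗ u) x₂ * ((inl ∘ₗ v) x₃ * (inr ∘ₗ v) x₄))) *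
        (join (inr ∘ₗ u) (inl ∘ₗ u) X *
          (join (inl ∘ₗ v) (inr ∘ₗ v) Y * join (inr ∘ₗ w) (inl ∘ₗ w) Z)) *
        ((inl ∘ₗ v) y₁ * ((inr ∘ₗ v) y₂ * ((inr ∘ₗ w) y₃ * (inl ∘ₗ w) y₄)))) =
      q.sswap X * ((q.S x₂ * q.alpha * x₃) ⊗ₜ[k] (q.S x₁ * q.alpha * x₄)) * Y *
        ((y₁ * q.beta * q.S y₄) ⊗ₜ[k] (y₂ * q.beta * q.S y₃)) * q.sswap Z := by
    intro x₁ x₂ x₃ x₄ y₁ y₂ y₃ y₄ X Y Z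
    induction X using TensorProduct.induction_on with
    | zero => simp
    | add X X' hX hX' => simp only [add_mul, mul_add, map_add, hX, hX']
    | tmul x x' =>
      induction Y using TensorProduct.induction_on with
      | zero => simp
      | add Y Y' hY hY' => simp only [add_mul, mul_add, map_add, hY, hY']
      | tmul y y' =>
        induction Z using TensorProduct.induction_on with
        | zero => simp
        | add Z Z' hZ hZ' => simp only [add_mul, mul_add, map_add, hZ, hZ']
        | tmul z z' =>
          simp only [join_tmul, LinearMap.comp_apply, inl_apply, inr_apply,
            Algebra.TensorProduct.tmul_mul_tmul, one_mul, mul_one, TensorProduct.map_tmul,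
            sswap_tmul]
          simp only [mul_assoc] at hN ⊢
          simp only [hN]
  have key : ∀ X Y Z : H ⊗[k] H,
      TensorProduct.map N N ((q.assocInv (inl ∘ₗ u) (inl ∘ₗ v) (inr ∘ₗ v) *
          q.assoc (inr ∘ₗ u) (inl ∘ₗ u) (q.star (inl ∘ₗ v) (inr ∘ₗ v))) *
        (join (inr ∘ₗ u) (inl ∘ₗ u) X *
          (join (inl ∘ₗ v) (inr ∘ₗ v) Y * join (inr ∘ₗ w) (inl ∘ₗ w) Z)) *
        (q.assoc (q.star (inl ∘ₗ v) (inr ∘ₗ v)) (inr ∘ₗ w) (inl ∘ₗ w) *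
          q.assocInv (inl ∘ₗ v) (inr ∘ₗ v) (inr ∘ₗ w))) =
      q.sswap X * q.aEl * Y * q.bEl * q.sswap Z := by
    intro X Y Z
    rw [L4.assocInv_mul_assoc_eq_sum q, L4'.assoc_mul_assocInv_eq_sum q]
    simp only [aEl, bEl, Finset.sum_mul, Finset.mul_sum, map_sum, link]
    simp only [mul_assoc, q.S_mul]
  have e := L6.collapse_six q (N := TensorProduct.map N N)
    (by rw [star_inl_comp, ← inl_comp_unitLeg]; exact hl.map_inl N)
    (by rw [star_inr_comp, ← inr_comp_unitLeg]; exact hl.map_inr N)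
    (by rw [star_inr_comp, ← inr_comp_unitLeg]; exact hr.map_inr N)
    (by rw [star_inl_comp, ← inl_comp_unitLeg]; exact hr.map_inl N)
  rw [assocInv_inl_comp, assocInv_inr_comp, mul_assoc (_ * _ * _), map_middle_eq_sum] at e
  simp only [key, inl_apply, inr_apply, Algebra.TensorProduct.tmul_mul_tmul, one_mul, mul_one,
    TensorProduct.map_tmul, hone, ← scop_eq] at e
  rw [e, Algebra.TensorProduct.one_def]

end TwistInverse

section Twist

variable {k H : Type} [Field k] [Ring H] [Algebra k H] (q : QuasiHopf k H)

lemma sum_scop_mul_aEl_mul_comul (h : H) :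
    ∑ i ∈ Finset.range (q.n h), q.scop (q.d1 h i) * q.aEl * q.comul (q.d2 h i) =
      q.counit h • q.aEl := by
  let K : H ⊗[k] H →ₗ[k] H := join (LinearMap.mulRight k q.alpha ∘ₗ q.S) LinearMap.id
  have hK : ∀ x y, K (x ⊗ₜ[k] y) = q.S x * q.alpha * y := by simp [K]
  refine q.scop_mul_aEl_mul_comul_aux (u := inl) (v := inr) (K := K) ?_ ?_ ?_ ?_ ?_ h
  · have h2 : Commuting (inl : H →ₗ[k] H ⊗[k] H) (inr : H →ₗ[k] H ⊗[k] H) :=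
      commuting_inl_inr (a := LinearMap.id) (b := LinearMap.id)
    simp [Legs, h2]
  · intro y X
    induction X using TensorProduct.induction_on with
    | zero => simp
    | add X X' hX hX' => simp only [add_mul, mul_add, map_add, hX, hX']
    | tmul x x' => simp [hK, q.S_mul, mul_assoc]
  · intro y X
    induction X using TensorProduct.induction_on with
    | zero => simp
    | add X X' hX hX' => simp only [add_mul, map_add, hX, hX']
    | tmul x x' => simp [hK, mul_assoc]
  · simp [Algebra.TensorProduct.one_def, hK, q.S_one]
  · intro h X
    rw [map_star_mul, map_unitLeg_mul]
    induction X using TensorProduct.induction_on with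
    | zero => simp
    | add X X' hX hX' => simp only [mul_add, map_add, Finset.sum_add_distrib, hX, hX', smul_add]
    | tmul x x' =>
      have e := congrArg (fun y => q.S x * y * x') (q.antipode_alpha h)
      simp only [Finset.mul_sum, Finset.sum_mul] at e
      simp only [inl_apply, inr_apply, Algebra.TensorProduct.tmul_mul_tmul, one_mul, hK, q.S_mul]
      simp only [mul_assoc, smul_mul_assoc, mul_smul_comm] at e ⊢
      exact e

lemma sum_scop_aEl_comul_bEl_scop :
    ∑ r ∈ Finset.range q.nq, q.scop (q.Q1 r) * q.aEl * q.comul (q.Q2 r) * q.bEl *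
      q.scop (q.Q3 r) = 1 := by
  refine q.scop_aEl_comul_bEl_scop_aux (u := leg₁) (v := leg₂) (w := leg₃)
    (N := sandwich q.S q.alpha LinearMap.id q.beta q.S) legs_three ?_
    (q.leftCollapse_sandwich q.S_mul isHom_id q.antipode_alpha)
    (q.rightCollapse_sandwich q.S_mul isHom_id q.antipode_beta) ?_
  · intro x y x' y' z y'' z'
    simp [leg₁_apply, leg₂_apply, leg₃_apply, q.S_mul, mul_assoc]
  · rw [assocInv_legs, PhiInv, map_sum, ← q.nondeg_2]
    simp [mul_assoc]

lemma sum_comul_mul_comul_beta_mul_comul_S (h : H) :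
    ∑ i ∈ Finset.range (q.n h), q.comul (q.d1 h i) * q.comul q.beta * q.comul (q.S (q.d2 h i)) =
      q.counit h • q.comul q.beta := by
  simp only [← map_mul, ← map_sum, ← map_smul, q.antipode_beta]

lemma isHom_comul : IsHom q.comul.toLinearMap := ⟨by simp, by simp⟩

/-- `(S ⊗ S) ∘ Δ^cop` as a linear map. -/
def scopLin : H →ₗ[k] H ⊗[k] H := q.sswap ∘ₗ q.comul.toLinearMap

lemma scopLin_apply (h : H) : q.scopLin h = q.scop h := (q.scop_eq h).symm

lemma twist_eq_sandwich :
    q.twist = sandwich q.scopLin q.aEl q.comul.toLinearMap (q.comul q.beta)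
      (q.comul.toLinearMap ∘ₗ q.S) q.PhiInv := by
  simp [twist, PhiInv, scopLin_apply, pR1, pR2]

lemma twist_mul_comul_S (h : H) : q.twist * q.comul (q.S h) = q.scop h * q.twist := by
  rw [twist_eq_sandwich, ← scopLin_apply]
  refine q.sandwich_phiInv_mul (s' := q.comul.toLinearMap ∘ₗ q.S) ?_ ?_ q.isHom_comul ?_ ?_ h
  · intro x y
    simp [scopLin_apply, scop_mul]
  · intro x y
    simp [q.S_mul]
  · intro h
    simpa [scopLin_apply] using q.sum_scop_mul_aEl_mul_comul h
  · exact q.sum_comul_mul_comul_beta_mul_comul_S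

lemma twist_mul_comul_alpha : q.twist * q.comul q.alpha = q.aEl := by
  rw [twist_eq_sandwich]
  refine q.sandwich_phiInv_mul_alpha ?_ ?_ ?_ q.isHom_comul ?_ ?_ ?_ ?_
  · intro x y
    simp [scopLin_apply, scop_mul]
  · simp [scopLin, sswap_one]
  · intro x y
    simp [q.S_mul]
  · intro h
    simpa [scopLin_apply] using q.sum_scop_mul_aEl_mul_comul h
  · exact q.sum_comul_mul_comul_beta_mul_comul_S
  · intro h
    have e := congrArg q.comul (q.antipode_alpha h)
    simpa using e
  · have e := congrArg q.comul q.nondeg_1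
    simpa using e

lemma twist_mul_twistInv : q.twist * q.twistInv = 1 := by
  rw [← q.sum_scop_aEl_comul_bEl_scop, twistInv, Finset.mul_sum]
  refine Finset.sum_congr rfl fun r _ => ?_
  simp only [qL1, qL2, map_mul, ← mul_assoc]
  rw [twist_mul_comul_S, mul_assoc (q.scop _), twist_mul_comul_alpha]

end Twist

section Functionals

variable {k H : Type} [Field k] [Ring H] [Algebra k H] (q : QuasiHopf k H)

lemma sswap_WL (mu : H →ₐ[k] k) {g gi : H} (hpiv : ∀ h : H, g * h * gi = q.S (q.S h)) :
    q.sswap (q.WL mu) = (g ⊗ₜ[k] g) * ((TensorProduct.map (q.lhook mu) LinearMap.id q.qRE) *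
      (∑ b ∈ Finset.range q.nq, mu (q.Q1 b) • (q.Q2 b ⊗ₜ[k] q.Q3 b))) * (gi ⊗ₜ[k] gi) *
      q.sswap q.twistInv := by
  rw [WL, sswap_mul]
  congr 1
  generalize (TensorProduct.map (q.lhook mu) LinearMap.id q.qRE) * _ = X
  induction X using TensorProduct.induction_on with
  | zero => simp
  | add X Y hX hY => simp only [map_add, mul_add, add_mul, hX, hY]
  | tmul x y => simp [hpiv]

lemma S_hitR (t : H →ₗ[k] k) (gi : H) (Y : H ⊗[k] H) :
    q.S (hitR (t ∘ₗ LinearMap.mulLeft k gi ∘ₗ q.S) Y) =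
      hitL t ((gi ⊗ₜ[k] 1) * q.sswap Y) := by
  induction Y using TensorProduct.induction_on with
  | zero => simp
  | add X Y hX hY => simp only [map_add, mul_add, hX, hY]
  | tmul x y => simp [hitR, hitL]

lemma hitL_one_tmul_mul (t : H →ₗ[k] k) (g : H) (X : H ⊗[k] H) :
    hitL t ((1 ⊗ₜ[k] g) * X) = g * hitL t X := by
  induction X using TensorProduct.induction_on with
  | zero => simp
  | add X Y hX hY => simp only [map_add, mul_add, hX, hY]
  | tmul x y => simp [hitL]

end Functionals

end QuasiHopf

/-- For `t ∈ H*`, the trace condition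
`t(h) 1 = μ(φ̄1) t((q^R_1 ↼ μ) φ̄2 h₍₁₎ p^R_1) g q^R_2 φ̄3 h₍₂₎ p^R_2`
holds for all `h` if and only if `λ(h) := t(g⁻¹ S(h))` is a left cointegral, i.e.
`V^L_1 h₍₁₎ W^L_1 ⟨λ, V^L_2 h₍₂₎ W^L_2⟩ = λ(h) 1` for all `h`. -/
theorem statement19 (k H : Type) [Field k] [Ring H] [Algebra k H] (q : QuasiHopf k H)
    (mu : H →ₐ[k] k) (g gi : H) (hg1 : g * gi = 1) (hg2 : gi * g = 1)
    (hpiv : ∀ h : H, g * h * gi = q.S (q.S h))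
    (hDg : q.comul g = q.twistInv * q.sswap q.twist * (g ⊗ₜ[k] g))
    (t : H →ₗ[k] k) :
    (∀ h : H, t h • (1 : H) =
        g * hitL t ((TensorProduct.map (q.lhook mu) LinearMap.id q.qRE) *
          (∑ b ∈ Finset.range q.nq, mu (q.Q1 b) • (q.Q2 b ⊗ₜ[k] q.Q3 b)) *
          q.comul h * q.pRE)) ↔
    (∀ h : H, hitR (t ∘ₗ LinearMap.mulLeft k gi ∘ₗ q.S) (q.VL * q.comul h * q.WL mu) =
        t (gi * q.S h) • (1 : H)) := by
  have hG : (gi ⊗ₜ[k] gi) * (g ⊗ₜ[k] g) = (1 : H ⊗[k] H) := by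
    simp [hg2, Algebra.TensorProduct.one_def]
  have hr : q.twistInv * (q.sswap q.twist * (g ⊗ₜ[k] g) * q.comul gi) = 1 := by
    rw [← mul_assoc, ← mul_assoc, ← hDg, ← map_mul, hg1, map_one]
  have hf : q.twist = q.sswap q.twist * (g ⊗ₜ[k] g) * q.comul gi :=
    left_inv_eq_right_inv q.twist_mul_twistInv hr
  have hgi : (gi ⊗ₜ[k] gi) * q.sswap q.twistInv * q.twist = q.comul gi := by
    rw [hf, mul_assoc, mul_assoc (q.sswap q.twist), ← mul_assoc (q.sswap q.twistInv),
      ← q.sswap_mul, q.twist_mul_twistInv, q.sswap_one, one_mul, ← mul_assoc, hG, one_mul]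
  have key : ∀ h, q.S (hitR (t ∘ₗ LinearMap.mulLeft k gi ∘ₗ q.S)
      (q.VL * q.comul h * q.WL mu)) =
      g * hitL t ((TensorProduct.map (q.lhook mu) LinearMap.id q.qRE) *
        (∑ b ∈ Finset.range q.nq, mu (q.Q1 b) • (q.Q2 b ⊗ₜ[k] q.Q3 b)) *
        q.comul (gi * q.S h) * q.pRE) := by
    intro h
    rw [q.S_hitR, q.sswap_mul, q.sswap_mul, q.sswap_WL mu hpiv, QuasiHopf.VL, q.sswap_sswapInv,
      ← q.scop_eq, ← QuasiHopf.hitL_one_tmul_mul, ← mul_assoc (q.scop h), ← q.twist_mul_comul_S,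
      map_mul q.comul, ← hgi]
    have h1 : (1 : H) ⊗ₜ[k] g = (gi ⊗ₜ[k] 1) * (g ⊗ₜ[k] g) := by simp [hg2]
    rw [h1]
    simp only [mul_assoc]
  have S_inj : Function.Injective q.S := Function.LeftInverse.injective q.Sinv_S
  have S_smul : ∀ c : k, q.S (c • 1) = c • (1 : H) := fun c => by rw [map_smul, q.S_one]
  constructor
  · intro hi h
    apply S_inj
    rw [key, S_smul, ← hi]
  · intro hii x
    have e := key (q.Sinv (g * x))
    rwa [hii, S_smul, q.S_Sinv, ← mul_assoc, hg2, one_mul] at e
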